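/- arXiv:2312.13988 — 3 statements merged into one kernel-verified Lean document; each statement's English description precedes it below -/
import Mathlib

section
/- Fix integers a ≥ 1 and 0 ≤ λ ≤ a − 1. For every irrational x ∈ (0,1) and every j ≥ 0 with a_{j+1} = a and (j, λ) ≠ (0,0), the fraction m_j := (λ p_j + p_{j−1})/(λ q_j + q_{j−1}) satisfies (a−λ)λ/a < Θ(x, m_j) < (a−λ+1)(λ+1)/(a+2). Moreover, for Lebesgue-almost every irrational x ∈ (0,1) the set {j ≥ 0 : a_{j+1} = a} is infinite and, enumerating it increasingly as j_0 < j_1 < ⋯ and setting C := log((a+1)²/(a(a+2))), the limit L(z) := lim_{n→∞} (1/n) · #{0 ≤ k < n : Θ(x, m_{j_k}) ≤ z} exists for all z and equals: (1/C)·(a z/((a−λ)λ) − 1 + log((a−λ)λ/(a z))) whenever λ ≥ 1 and (a−λ)λ/a ≤ z ≤ min{(a−λ+1)λ, (a−λ)(λ+1)}/(a+1); (1/C)·(z/(λ(λ+1)) + log((a+1)λ/(a(λ+1)))) whenever (a−λ)(λ+1)/(a+1) ≤ z ≤ (a−λ+1)λ/(a+1); (1/C)·(z/((a−λ)(a−λ+1))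 + log((a+1)(a−λ)/(a(a−λ+1)))) whenever (a−λ+1)λ/(a+1) ≤ z ≤ (a−λ)(λ+1)/(a+1); (1/C)·(1 − (a+2)z/((a−λ+1)(λ+1)) + log((a+1)² z/(a(a−λ+1)(λ+1)))) whenever max{(a−λ+1)λ, (a−λ)(λ+1)}/(a+1) ≤ z ≤ (a−λ+1)(λ+1)/(a+2). -/
open MeasureTheory Filter Topology
open scoped Classical

noncomputable section

/-- The Farey tent map `F`. -/
def fareyMap (x : ℝ) : ℝ := if x ≤ 1/2 then x / (1 - x) else (1 - x) / x

/-- `eps x n = ε_{n+1}(x)`, i.e. `0` if `F^[n] x ≤ 1/2` and `1` otherwise. -/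
def eps (x : ℝ) (n : ℕ) : ℤ := if fareyMap^[n] x ≤ 1/2 then 0 else 1

/-- The matrices `A_0 = [[1,0],[1,1]]` and `A_1 = [[0,1],[1,1]]`. -/
def Amat (e : ℤ) : Matrix (Fin 2) (Fin 2) ℤ := !![1 - e, e; 1, 1]

/-- `Mmat x n = A_{ε_1(x)} ⋯ A_{ε_n(x)}`, with `Mmat x 0` the identity. -/
def Mmat (x : ℝ) : ℕ → Matrix (Fin 2) (Fin 2) ℤ
  | 0 => 1
  | n + 1 => Mmat x n * Amat (eps x n)

/-- `u_n(x)`: top-left entry of `M_n(x)`. -/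
def uF (x : ℝ) (n : ℕ) : ℤ := Mmat x n 0 0

/-- `s_n(x)`: bottom-left entry of `M_n(x)`. -/
def sF (x : ℝ) (n : ℕ) : ℤ := Mmat x n 1 0

/-- Ito's natural extension `F̄` of the Farey tent map. -/
def fareyNE (p : ℝ × ℝ) : ℝ × ℝ :=
  if p.1 ≤ 1/2 then (p.1 / (1 - p.1), p.2 / (1 + p.2))
  else ((1 - p.1) / p.1, 1 / (1 + p.2))

/-- `Ω = [0,1]²`. -/
def OmegaSet : Set (ℝ × ℝ) := Set.Icc (0:ℝ) 1 ×ˢ Set.Icc (0:ℝ) 1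

/-- The measure `μ̄` on `Ω` with density `(x + y − xy)⁻²` w.r.t. Lebesgue measure. -/
def muBar : Measure (ℝ × ℝ) :=
  (volume.restrict OmegaSet).withDensity
    (fun p => ENNReal.ofReal (1 / (p.1 + p.2 - p.1 * p.2) ^ 2))

/-- A proper inducible subregion of `Ω`. -/
def ProperInducible (R : Set (ℝ × ℝ)) : Prop :=
  R ⊆ OmegaSet ∧ MeasurableSet R ∧ 0 < muBar R ∧ muBar R < ⊤ ∧ muBar (frontier R) = 0

/-- `hitsR R x k` holds iff `k ≥ 1` and `F̄^[k] (x,1) ∈ R`. -/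
def hitsR (R : Set (ℝ × ℝ)) (x : ℝ) (k : ℕ) : Prop := 1 ≤ k ∧ fareyNE^[k] (x, 1) ∈ R

/-- `Nidx R x n = N_n`: `N_0 = 0` and, for `n ≥ 1`, the `n`-th smallest `k ≥ 1`
with `F̄^[k] (x,1) ∈ R`. -/
def Nidx (R : Set (ℝ × ℝ)) (x : ℝ) : ℕ → ℕ
  | 0 => 0
  | n + 1 => Nat.nth (hitsR R x) n

/-- `h(x,y) = (1−y)/(x + y − xy)`. -/
def hIto (p : ℝ × ℝ) : ℝ := (1 - p.2) / (p.1 + p.2 - p.1 * p.2)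

/-- `Θ_n(x) = s_n(x)·|s_n(x)·x − u_n(x)|`, the approximation coefficient of the
`n`-th Farey convergent `u_n(x)/s_n(x)`. -/
def ThetaF (x : ℝ) (n : ℕ) : ℝ := (sF x n : ℝ) * |(sF x n : ℝ) * x - (uF x n : ℝ)|

/-- `Θ_n^R(x) = s_n^R·|s_n^R·x − u_n^R|` where `u_n^R = u_{N_n}(x)`, `s_n^R = s_{N_n}(x)`. -/
def ThetaR (R : Set (ℝ × ℝ)) (x : ℝ) (n : ℕ) : ℝ := ThetaF x (Nidx R x n)

/-- The Gauss map. -/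
def gaussMap (x : ℝ) : ℝ := Int.fract (1 / x)

/-- `pquot x n` is the RCF partial quotient `a_{n+1}(x)`. -/
def pquot (x : ℝ) (n : ℕ) : ℤ := ⌊1 / (gaussMap^[n] x)⌋

/-- `pnum x (j+1)` is the RCF numerator `p_j(x)`; `pnum x 0 = p_{-1} = 1`. -/
def pnum (x : ℝ) : ℕ → ℤ
  | 0 => 1
  | 1 => 0
  | n + 2 => pquot x n * pnum x (n + 1) + pnum x n

/-- `qden x (j+1)` is the RCF denominator `q_j(x)`; `qden x 0 = q_{-1} = 0`. -/
def qden (x : ℝ) : ℕ → ℤ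
  | 0 => 0
  | 1 => 1
  | n + 2 => pquot x n * qden x (n + 1) + qden x n

/-- The approximation coefficient `Θ(x, p/q) = q·|q·x − p|`. -/
def Theta (x : ℝ) (p q : ℤ) : ℝ := (q : ℝ) * |(q : ℝ) * x - (p : ℝ)|

/-- `medTheta x l j = Θ(x, (l·p_j + p_{j−1})/(l·q_j + q_{j−1}))`. -/
def medTheta (x : ℝ) (l : ℤ) (j : ℕ) : ℝ :=
  Theta x (l * pnum x (j + 1) + pnum x j) (l * qden x (j + 1) + qden x j)

end

/-- The normalising constant `C = log((a+1)²/(a(a+2)))`. -/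
noncomputable def C11 (a : ℕ) : ℝ := Real.log (((a:ℝ) + 1) ^ 2 / ((a:ℝ) * ((a:ℝ) + 2)))

/-- The maximal function `max_{0 ≤ k ≤ n} birkhoffSum S g k`, defined recursively. -/
def maxBirkhoffSum {Ω : Type*} (S : Ω → Ω) (g : Ω → ℝ) : ℕ → Ω → ℝ
  | 0 => fun _ => 0
  | n + 1 => fun p => max 0 (g p + maxBirkhoffSum S g n (S p))

section MaximalErgodic

variable {Ω : Type*} {S : Ω → Ω} {g : Ω → ℝ}

lemma maxBirkhoffSum_nonneg (n : ℕ) (p : Ω) : 0 ≤ maxBirkhoffSum S g n p := by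
  cases n with
  | zero => exact le_rfl
  | succ n => exact le_max_left _ _

lemma maxBirkhoffSum_le_succ (n : ℕ) (p : Ω) :
    maxBirkhoffSum S g n p ≤ maxBirkhoffSum S g (n + 1) p := by
  induction n generalizing p with
  | zero => exact maxBirkhoffSum_nonneg 1 p
  | succ n ih => exact max_le_max le_rfl (by linarith [ih (S p)])

lemma birkhoffSum_le_maxBirkhoffSum (n : ℕ) (p : Ω) :
    birkhoffSum S g n p ≤ maxBirkhoffSum S g n p := by
  induction n generalizing p with
  | zero => simp [maxBirkhoffSum]
  | succ n ih =>
    rw [birkhoffSum_succ']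
    exact le_trans (by linarith [ih (S p)]) (le_max_right _ _)

lemma maxBirkhoffSum_sub_le (n : ℕ) (p : Ω) :
    maxBirkhoffSum S g n p - maxBirkhoffSum S g n (S p) ≤
      {p | 0 < maxBirkhoffSum S g n p}.indicator g p := by
  by_cases h : 0 < maxBirkhoffSum S g n p
  · rw [Set.indicator_of_mem (by exact h)]
    cases n with
    | zero => exact absurd h (lt_irrefl _)
    | succ n =>
      have h1 := maxBirkhoffSum_le_succ (S := S) (g := g) n (S p)
      have h2 : maxBirkhoffSum S g (n + 1) p = g p + maxBirkhoffSum S g n (S p) := by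
        rcases max_choice 0 (g p + maxBirkhoffSum S g n (S p)) with h3 | h3
        · exact absurd h (by simp only [maxBirkhoffSum]; rw [h3]; exact lt_irrefl _)
        · exact h3
      linarith
  · rw [Set.indicator_of_notMem (by exact h)]
    linarith [maxBirkhoffSum_nonneg (S := S) (g := g) n (S p)]

variable [MeasurableSpace Ω]

lemma measurable_maxBirkhoffSum (hS : Measurable S) (hg : Measurable g) (n : ℕ) :
    Measurable (maxBirkhoffSum S g n) := by
  induction n with
  | zero => exact measurable_const
  | succ n ih => exact measurable_const.max (hg.add (ih.comp hS))

variable {ν : Measure Ω}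

lemma integrable_maxBirkhoffSum (hS : MeasurePreserving S ν ν)
    (hg : Integrable g ν) (n : ℕ) : Integrable (maxBirkhoffSum S g n) ν := by
  induction n with
  | zero => exact integrable_zero _ _ _
  | succ n ih =>
    exact (integrable_zero Ω ℝ ν).sup (hg.add (hS.integrable_comp_of_integrable ih))

/-- The maximal ergodic theorem, for functions with an eventually positive Birkhoff sum. -/
theorem integral_nonneg_of_ae_exists_birkhoffSum_pos (hS : MeasurePreserving S ν ν)
    (hgm : Measurable g) (hg : Integrable g ν)
    (h : ∀ᵐ p ∂ν, ∃ n, 0 < birkhoffSum S g n p) : 0 ≤ ∫ p, g p ∂ν := by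
  have hms : ∀ n, MeasurableSet {p | 0 < maxBirkhoffSum S g n p} := fun n =>
    measurableSet_lt measurable_const (measurable_maxBirkhoffSum hS.measurable hgm n)
  have key : ∀ n, 0 ≤ ∫ p, {p | 0 < maxBirkhoffSum S g n p}.indicator g p ∂ν := by
    intro n
    have hi := integrable_maxBirkhoffSum hS hg n
    have hi' : Integrable (fun p => maxBirkhoffSum S g n (S p)) ν :=
      hS.integrable_comp_of_integrable hi
    have h0 : ∫ p, (maxBirkhoffSum S g n p - maxBirkhoffSum S g n (S p)) ∂ν = 0 := by
      rw [integral_sub hi hi', sub_eq_zero]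
      have := integral_map (μ := ν) hS.measurable.aemeasurable (f := maxBirkhoffSum S g n)
        (by rw [hS.map_eq]; exact hi.aestronglyMeasurable)
      rw [hS.map_eq] at this
      exact this
    refine h0.symm.le.trans ?_
    exact integral_mono (hi.sub hi') (hg.indicator (hms n)) (maxBirkhoffSum_sub_le n)
  have lim : Tendsto (fun n => ∫ p, {p | 0 < maxBirkhoffSum S g n p}.indicator g p ∂ν) atTop
      (𝓝 (∫ p, g p ∂ν)) := by
    refine tendsto_integral_of_dominated_convergence (fun p => ‖g p‖)
      (fun n => (hgm.indicator (hms n)).aestronglyMeasurable) hg.norm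
      (fun n => Eventually.of_forall fun p => norm_indicator_le_norm_self _ _) ?_
    filter_upwards [h] with p ⟨n, hn⟩
    refine tendsto_const_nhds.congr' ?_
    filter_upwards [eventually_ge_atTop n] with m hm
    refine (Set.indicator_of_mem ?_ _).symm
    exact (hn.trans_le (birkhoffSum_le_maxBirkhoffSum n p)).trans_le
      (monotone_nat_of_le_succ (fun k => maxBirkhoffSum_le_succ (S := S) (g := g) k p) hm)
  exact ge_of_tendsto' lim key

end MaximalErgodic

/-- The irrational numbers in `(0, 1)`. -/
def unitIrrational : Set ℝ := {t | t ∈ Set.Ioo (0 : ℝ) 1 ∧ Irrational t}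

/-- The natural extension of the Gauss map. -/
noncomputable def gaussNE (p : ℝ × ℝ) : ℝ × ℝ := (gaussMap p.1, 1 / ((⌊1 / p.1⌋ : ℝ) + p.2))

/-- The inverse branch of `gaussMap^[n]` on the cylinder of rank `n` containing `x`. -/
noncomputable def cylMap (x : ℝ) (n : ℕ) (t : ℝ) : ℝ :=
  ((pnum x (n + 1) : ℝ) + t * pnum x n) / ((qden x (n + 1) : ℝ) + t * qden x n)

section Orbits

variable {x t : ℝ}

lemma one_div_eq_floor_add_gaussMap (t : ℝ) : 1 / t = (⌊1 / t⌋ : ℝ) + gaussMap t :=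
  (Int.floor_add_fract (1 / t)).symm

lemma one_le_floor_one_div (ht : t ∈ unitIrrational) : 1 ≤ ⌊1 / t⌋ := by
  rw [Int.le_floor, Int.cast_one]
  exact (one_lt_one_div ht.1.1 ht.1.2).le

lemma gaussMap_mem (ht : t ∈ unitIrrational) : gaussMap t ∈ unitIrrational := by
  have hirr : Irrational (gaussMap t) := by
    have : gaussMap t = t⁻¹ - (⌊1 / t⌋ : ℤ) := by
      have := one_div_eq_floor_add_gaussMap t
      rw [one_div] at this ⊢
      linarith
    rw [this]
    exact (irrational_inv_iff.2 ht.2).sub_intCast _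
  exact ⟨⟨lt_of_le_of_ne (Int.fract_nonneg _) (Ne.symm hirr.ne_zero), Int.fract_lt_one _⟩, hirr⟩

lemma iterate_gaussMap_mem (hx : x ∈ unitIrrational) (n : ℕ) :
    gaussMap^[n] x ∈ unitIrrational := by
  induction n with
  | zero => exact hx
  | succ n ih => rw [Function.iterate_succ_apply']; exact gaussMap_mem ih

lemma one_le_pquot (hx : x ∈ unitIrrational) (n : ℕ) : 1 ≤ pquot x n :=
  one_le_floor_one_div (iterate_gaussMap_mem hx n)

lemma one_div_intCast_add_mem (ht : t ∈ unitIrrational) {m : ℤ} (hm : 1 ≤ m) :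
    1 / ((m : ℝ) + t) ∈ unitIrrational := by
  have hm' : (1 : ℝ) ≤ m := by exact_mod_cast hm
  have h0 := ht.1.1
  refine ⟨⟨by positivity, ?_⟩, ?_⟩
  · rw [div_lt_one (by positivity)]; linarith
  · rw [one_div]; exact irrational_inv_iff.2 (ht.2.intCast_add m)

lemma floor_one_div_one_div_add (ht : t ∈ Set.Ico (0 : ℝ) 1) (m : ℤ) :
    ⌊1 / (1 / ((m : ℝ) + t))⌋ = m := by
  rw [one_div_one_div, Int.floor_intCast_add, Int.floor_eq_zero_iff.2 ht, add_zero]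

lemma gaussMap_one_div_add (ht : t ∈ Set.Ico (0 : ℝ) 1) (m : ℤ) :
    gaussMap (1 / ((m : ℝ) + t)) = t := by
  rw [gaussMap, one_div_one_div, Int.fract_intCast_add, Int.fract_eq_self.2 ht]

lemma iterate_gaussMap_eq (x : ℝ) (n : ℕ) :
    gaussMap^[n] x = 1 / ((pquot x n : ℝ) + gaussMap^[n + 1] x) := by
  rw [Function.iterate_succ_apply', pquot, ← one_div_eq_floor_add_gaussMap, one_div_one_div]

lemma qden_nonneg_and_one_le (hx : x ∈ unitIrrational) (n : ℕ) :
    0 ≤ qden x n ∧ 1 ≤ qden x (n + 1) := by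
  induction n with
  | zero => simp [qden]
  | succ n ih =>
    have h3 : qden x (n + 1 + 1) = pquot x n * qden x (n + 1) + qden x n := rfl
    have h4 : qden x (n + 1) ≤ pquot x n * qden x (n + 1) :=
      le_mul_of_one_le_left (by lia) (one_le_pquot hx n)
    lia

lemma qden_add_le (hx : x ∈ unitIrrational) (n : ℕ) :
    qden x (n + 1) + qden x n ≤ qden x (n + 2) := by
  have h3 : qden x (n + 2) = pquot x n * qden x (n + 1) + qden x n := rfl
  have h4 : qden x (n + 1) ≤ pquot x n * qden x (n + 1) :=
    le_mul_of_one_le_left (by linarith [(qden_nonneg_and_one_le hx n).2]) (one_le_pquot hx n)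
  lia

lemma natCast_le_qden (hx : x ∈ unitIrrational) (n : ℕ) : (n : ℤ) ≤ qden x (n + 1) := by
  induction n with
  | zero => simp [qden]
  | succ n ih =>
    have h3 := qden_add_le hx n
    cases n with
    | zero => simpa using (qden_nonneg_and_one_le hx 1).2
    | succ k =>
      have := (qden_nonneg_and_one_le hx k).2
      push_cast at ih ⊢
      lia

lemma qden_le_succ (hx : x ∈ unitIrrational) (n : ℕ) : qden x n ≤ qden x (n + 1) := by
  cases n with
  | zero => simp [qden]
  | succ n => linarith [qden_add_le hx n, (qden_nonneg_and_one_le hx n).1]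

lemma pnum_mul_qden_sub (x : ℝ) (n : ℕ) :
    pnum x (n + 1) * qden x n - pnum x n * qden x (n + 1) = (-1) ^ (n + 1) := by
  induction n with
  | zero => simp [pnum, qden]
  | succ n ih =>
    have h1 : qden x (n + 1 + 1) = pquot x n * qden x (n + 1) + qden x n := rfl
    have h2 : pnum x (n + 1 + 1) = pquot x n * pnum x (n + 1) + pnum x n := rfl
    rw [h1, h2, pow_succ, ← ih]; ring

lemma qden_add_pos (hx : x ∈ unitIrrational) (n : ℕ) (ht : 0 ≤ t) :
    0 < (qden x (n + 1) : ℝ) + t * qden x n := by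
  have h1 : (0 : ℝ) ≤ qden x n := by exact_mod_cast (qden_nonneg_and_one_le hx n).1
  have h2 : (1 : ℝ) ≤ qden x (n + 1) := by exact_mod_cast (qden_nonneg_and_one_le hx n).2
  positivity

lemma cylMap_zero (x t : ℝ) : cylMap x 0 t = t := by
  simp [cylMap, pnum, qden]

lemma cylMap_succ (hx : x ∈ unitIrrational) (n : ℕ) (ht : 0 ≤ t) :
    cylMap x (n + 1) t = cylMap x n (1 / ((pquot x n : ℝ) + t)) := by
  have h1 : (qden x (n + 1 + 1) : ℝ) = pquot x n * qden x (n + 1) + qden x n := by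
    exact_mod_cast (rfl : qden x (n + 1 + 1) = pquot x n * qden x (n + 1) + qden x n)
  have h2 : (pnum x (n + 1 + 1) : ℝ) = pquot x n * pnum x (n + 1) + pnum x n := by
    exact_mod_cast (rfl : pnum x (n + 1 + 1) = pquot x n * pnum x (n + 1) + pnum x n)
  have h3 : (1 : ℝ) ≤ pquot x n := by exact_mod_cast one_le_pquot hx n
  have h4 := qden_add_pos hx (n + 1) ht
  have h5 := qden_add_pos hx n (t := 1 / ((pquot x n : ℝ) + t)) (by positivity)
  unfold cylMap
  rw [div_eq_div_iff h4.ne' h5.ne', h1, h2]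
  have : (pquot x n : ℝ) + t ≠ 0 := by positivity
  field_simp
  ring

lemma cylMap_iterate (hx : x ∈ unitIrrational) (n : ℕ) : cylMap x n (gaussMap^[n] x) = x := by
  induction n with
  | zero => simp [cylMap_zero]
  | succ n ih =>
    rw [cylMap_succ hx n (iterate_gaussMap_mem hx _).1.1.le, ← iterate_gaussMap_eq, ih]

lemma cylMap_mem_and_iterate_cylMap (hx : x ∈ unitIrrational) (n : ℕ) (ht : t ∈ unitIrrational) :
    cylMap x n t ∈ unitIrrational ∧ gaussMap^[n] (cylMap x n t) = t := by
  induction n generalizing t with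
  | zero => simpa [cylMap_zero] using ht
  | succ n ih =>
    obtain ⟨h1, h2⟩ := ih (one_div_intCast_add_mem ht (one_le_pquot hx n))
    rw [cylMap_succ hx n ht.1.1.le, Function.iterate_succ_apply', h2]
    exact ⟨h1, gaussMap_one_div_add ⟨ht.1.1.le, ht.1.2⟩ _⟩

lemma iterate_gaussNE_fst (p : ℝ × ℝ) (n : ℕ) : (gaussNE^[n] p).1 = gaussMap^[n] p.1 := by
  induction n with
  | zero => rfl
  | succ n ih => rw [Function.iterate_succ_apply', Function.iterate_succ_apply', gaussNE, ih]

lemma iterate_gaussNE_snd_succ (p : ℝ × ℝ) (n : ℕ) :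
    (gaussNE^[n + 1] p).2 = 1 / ((pquot p.1 n : ℝ) + (gaussNE^[n] p).2) := by
  rw [Function.iterate_succ_apply', gaussNE, iterate_gaussNE_fst, pquot]

lemma iterate_gaussNE_zero_snd (hx : x ∈ unitIrrational) (n : ℕ) :
    (gaussNE^[n] (x, 0)).2 = (qden x n : ℝ) / qden x (n + 1) := by
  induction n with
  | zero => simp [qden]
  | succ n ih =>
    have h1 : (qden x (n + 1 + 1) : ℝ) = pquot x n * qden x (n + 1) + qden x n := by
      exact_mod_cast (rfl : qden x (n + 1 + 1) = pquot x n * qden x (n + 1) + qden x n)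
    have h2 : (1 : ℝ) ≤ qden x (n + 1) := by exact_mod_cast (qden_nonneg_and_one_le hx n).2
    have h2' : (0 : ℝ) ≤ qden x n := by exact_mod_cast (qden_nonneg_and_one_le hx n).1
    have h3 : (1 : ℝ) ≤ pquot x n := by exact_mod_cast one_le_pquot hx n
    rw [iterate_gaussNE_snd_succ, ih, h1]
    field_simp

lemma iterate_gaussNE_snd_mem (hx : x ∈ unitIrrational) {v : ℝ} (hv : v ∈ Set.Icc (0 : ℝ) 1)
    (n : ℕ) : (gaussNE^[n] (x, v)).2 ∈ Set.Icc (0 : ℝ) 1 := by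
  induction n with
  | zero => exact hv
  | succ n ih =>
    have h3 : (1 : ℝ) ≤ pquot x n := by exact_mod_cast one_le_pquot hx n
    rw [iterate_gaussNE_snd_succ]
    have := ih.1
    exact ⟨by positivity, by rw [div_le_one (by positivity)]; simp only; linarith⟩

lemma abs_one_div_one_div_sub_le {m k v w : ℝ} (hm : 1 ≤ m) (hk : 1 ≤ k) (hv : 0 ≤ v)
    (hw : 0 ≤ w) :
    |1 / (m + 1 / (k + v)) - 1 / (m + 1 / (k + w))| ≤ |v - w| / 4 := by
  have e : 1 / (m + 1 / (k + v)) - 1 / (m + 1 / (k + w))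
      = (v - w) / ((m * (k + v) + 1) * (m * (k + w) + 1)) := by
    field_simp; ring
  rw [e, abs_div]
  have h1 : 2 ≤ m * (k + v) + 1 := by nlinarith
  have h2 : 2 ≤ m * (k + w) + 1 := by nlinarith
  have h3 : 4 ≤ (m * (k + v) + 1) * (m * (k + w) + 1) := by nlinarith
  rw [abs_of_nonneg (by linarith : 0 ≤ (m * (k + v) + 1) * (m * (k + w) + 1))]
  exact div_le_div_of_nonneg_left (abs_nonneg _) (by norm_num) h3

/-- The second coordinates of two `gaussNE`-orbits over the same point approach each other. -/
lemma abs_iterate_gaussNE_snd_sub_le (hx : x ∈ unitIrrational) {v w : ℝ}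
    (hv : v ∈ Set.Icc (0 : ℝ) 1) (hw : w ∈ Set.Icc (0 : ℝ) 1) (n : ℕ) :
    |(gaussNE^[n] (x, v)).2 - (gaussNE^[n] (x, w)).2| ≤ 2 * (1 / 2) ^ n := by
  induction n using Nat.twoStepInduction with
  | zero =>
    simp only [Function.iterate_zero, id]
    rw [abs_le]; constructor <;> linarith [hv.1, hv.2, hw.1, hw.2]
  | one =>
    have hv' := iterate_gaussNE_snd_mem hx hv 1
    have hw' := iterate_gaussNE_snd_mem hx hw 1
    rw [abs_le]; constructor <;> linarith [hv'.1, hv'.2, hw'.1, hw'.2]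
  | more n ih _ =>
    rw [iterate_gaussNE_snd_succ, iterate_gaussNE_snd_succ _ (n + 1), iterate_gaussNE_snd_succ,
      iterate_gaussNE_snd_succ]
    refine (abs_one_div_one_div_sub_le (by exact_mod_cast one_le_pquot hx _)
      (by exact_mod_cast one_le_pquot hx _) (iterate_gaussNE_snd_mem hx hv n).1
      (iterate_gaussNE_snd_mem hx hw n).1).trans ?_
    rw [pow_succ, pow_succ]
    linarith

/-- The mediant approximation coefficients as a function on the natural extension. -/
noncomputable def medThetaNE (l : ℝ) (p : ℝ × ℝ) : ℝ :=
  (l + p.2) * (1 - l * p.1) / (1 + p.1 * p.2)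

lemma medTheta_eq (hx : x ∈ unitIrrational) {l : ℕ} {n : ℕ} (hl : (l : ℤ) ≤ pquot x n) :
    medTheta x l n = medThetaNE l (gaussNE^[n] (x, 0)) := by
  have hq : (1 : ℝ) ≤ qden x (n + 1) := by exact_mod_cast (qden_nonneg_and_one_le hx n).2
  have hq' : (0 : ℝ) ≤ qden x n := by exact_mod_cast (qden_nonneg_and_one_le hx n).1
  have hl' : (l : ℝ) ≤ pquot x n := by exact_mod_cast hl
  have ht := (iterate_gaussMap_mem hx n).1
  have hlt : 0 ≤ 1 - l * gaussMap^[n] x := by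
    have h1 : (pquot x n : ℝ) ≤ 1 / gaussMap^[n] x := Int.floor_le _
    have h2 := (le_div_iff₀ ht.1).1 (hl'.trans h1)
    linarith
  have hdet : ((pnum x (n + 1) : ℝ) * qden x n - pnum x n * qden x (n + 1)) = (-1) ^ (n + 1) := by
    exact_mod_cast pnum_mul_qden_sub x n
  have hx' := cylMap_iterate hx n
  rw [medThetaNE, iterate_gaussNE_fst, iterate_gaussNE_zero_snd hx, medTheta, Theta]
  simp only
  set t := gaussMap^[n] x with htdef
  have hd := qden_add_pos hx n ht.1.le
  have e : ((l * qden x (n + 1) + qden x n : ℤ) : ℝ) * x - ((l * pnum x (n + 1) + pnum x n : ℤ) : ℝ)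
      = (-1) ^ (n + 1) * ((1 - l * t) / ((qden x (n + 1) : ℝ) + t * qden x n)) := by
    have hxe : x * ((qden x (n + 1) : ℝ) + t * qden x n) = (pnum x (n + 1) : ℝ) + t * pnum x n :=
      ((div_eq_iff hd.ne').1 hx').symm
    rw [← hdet, ← mul_div_assoc, eq_div_iff hd.ne']
    push_cast
    linear_combination ((l : ℝ) * qden x (n + 1) + qden x n) * hxe
  rw [e, abs_mul, abs_pow, abs_neg, abs_one, one_pow, one_mul, abs_of_nonneg (by positivity)]
  push_cast
  field_simp

end Orbits

lemma measurableSet_unitIrrational : MeasurableSet unitIrrational := by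
  have : unitIrrational = Set.Ioo (0 : ℝ) 1 \ Set.range ((↑) : ℚ → ℝ) := by
    ext x; simp [unitIrrational, Irrational]
  rw [this]
  exact measurableSet_Ioo.diff (Set.countable_range _).measurableSet

lemma ae_mem_unitIrrational :
    ∀ᵐ x : ℝ, x ∈ Set.Ioo (0 : ℝ) 1 → x ∈ unitIrrational := by
  have : (Set.range ((↑) : ℚ → ℝ))ᶜ ∈ ae (volume : Measure ℝ) :=
    compl_mem_ae_iff.2 ((Set.countable_range _).measure_zero _)
  filter_upwards [this] with x hx h using ⟨h, hx⟩

lemma volume_unitIrrational : volume unitIrrational = 1 := by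
  have : unitIrrational =ᵐ[volume] Set.Ioo (0 : ℝ) 1 := by
    filter_upwards [ae_mem_unitIrrational] with x hx
    exact propext ⟨fun h => h.1, hx⟩
  rw [measure_congr this]; simp

section Cylinders

variable {x t : ℝ}

lemma mem_of_iterate_gaussMap_mem {E : Set ℝ} (hE : ∀ x ∈ unitIrrational, gaussMap x ∈ E → x ∈ E)
    (n : ℕ) {y : ℝ} (hy : y ∈ unitIrrational) (h : gaussMap^[n] y ∈ E) : y ∈ E := by
  induction n with
  | zero => exact h
  | succ n ih =>
    rw [Function.iterate_succ_apply'] at h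
    exact ih (hE _ (iterate_gaussMap_mem hy n) h)

lemma hasDerivAt_cylMap (hx : x ∈ unitIrrational) (n : ℕ) (ht : 0 ≤ t) :
    HasDerivAt (cylMap x n) ((-1) ^ n / ((qden x (n + 1) : ℝ) + t * qden x n) ^ 2) t := by
  have h1 : HasDerivAt (fun t : ℝ => (pnum x (n + 1) : ℝ) + t * pnum x n) (pnum x n) t := by
    simpa using ((hasDerivAt_id t).mul_const (pnum x n : ℝ)).const_add (pnum x (n + 1) : ℝ)
  have h2 : HasDerivAt (fun t : ℝ => (qden x (n + 1) : ℝ) + t * qden x n) (qden x n) t := by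
    simpa using ((hasDerivAt_id t).mul_const (qden x n : ℝ)).const_add (qden x (n + 1) : ℝ)
  have hdet : ((pnum x (n + 1) : ℝ) * qden x n - pnum x n * qden x (n + 1)) = (-1) ^ (n + 1) := by
    exact_mod_cast pnum_mul_qden_sub x n
  refine (h1.div h2 (qden_add_pos hx n ht).ne').congr_deriv ?_
  rw [pow_succ] at hdet
  congr 1
  linear_combination -hdet

lemma injOn_cylMap (hx : x ∈ unitIrrational) (n : ℕ) : Set.InjOn (cylMap x n) unitIrrational :=
  Set.LeftInvOn.injOn (f₁' := gaussMap^[n]) fun _ ht => (cylMap_mem_and_iterate_cylMap hx n ht).2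

/-- The midpoint of the cylinder of rank `n` containing `x`. -/
noncomputable def cylCenter (x : ℝ) (n : ℕ) : ℝ :=
  (pnum x (n + 1) : ℝ) / qden x (n + 1) +
    (-1) ^ n / ((qden x (n + 1) : ℝ) * (qden x (n + 1) + qden x n)) / 2

/-- Half the length of the cylinder of rank `n` containing `x`. -/
noncomputable def cylRadius (x : ℝ) (n : ℕ) : ℝ :=
  1 / ((qden x (n + 1) : ℝ) * (qden x (n + 1) + qden x n)) / 2

lemma cylMap_mem_closedBall (hx : x ∈ unitIrrational) (n : ℕ) (ht : t ∈ Set.Icc (0 : ℝ) 1) :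
    cylMap x n t ∈ Metric.closedBall (cylCenter x n) (cylRadius x n) := by
  have hq : (1 : ℝ) ≤ qden x (n + 1) := by exact_mod_cast (qden_nonneg_and_one_le hx n).2
  have hq' : (0 : ℝ) ≤ qden x n := by exact_mod_cast (qden_nonneg_and_one_le hx n).1
  have hdet : ((pnum x (n + 1) : ℝ) * qden x n - pnum x n * qden x (n + 1)) = (-1) ^ (n + 1) := by
    exact_mod_cast pnum_mul_qden_sub x n
  have hd := qden_add_pos hx n ht.1
  have hs : |(-1 : ℝ) ^ n| = 1 := by simp
  rw [pow_succ] at hdet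
  rw [Metric.mem_closedBall, Real.dist_eq, cylCenter, cylRadius, cylMap]
  generalize (-1 : ℝ) ^ n = s at *
  generalize (pnum x (n + 1) : ℝ) = P at *
  generalize (pnum x n : ℝ) = P' at *
  generalize (qden x (n + 1) : ℝ) = Q at *
  generalize (qden x n : ℝ) = Q' at *
  have e : (P + t * P') / (Q + t * Q') - (P / Q + s / (Q * (Q + Q')) / 2) =
      s * (t / (Q * (Q + t * Q')) - 1 / (Q * (Q + Q')) / 2) := by
    have hQ : Q ≠ 0 := by positivity
    have hQ2 : Q + Q' ≠ 0 := by positivity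
    have e1 : (P + t * P') / (Q + t * Q') - P / Q = s * (t / (Q * (Q + t * Q'))) := by
      rw [div_sub_div _ _ hd.ne' hQ, ← mul_div_assoc,
        div_eq_div_iff (by positivity) (by positivity)]
      linear_combination (-(t * Q * (Q + t * Q'))) * hdet
    rw [mul_sub, ← e1]; ring
  have hQQ : 0 < Q * (Q + Q') := by positivity
  rw [e, abs_mul, hs, one_mul, abs_le]
  have h1 : 0 ≤ t / (Q * (Q + t * Q')) := by have := ht.1; positivity
  have h2 : t / (Q * (Q + t * Q')) ≤ 2 * (1 / (Q * (Q + Q')) / 2) := by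
    rw [mul_div_cancel₀ _ two_ne_zero, div_le_div_iff₀ (by positivity) hQQ]
    have : 0 ≤ Q * Q * (1 - t) := by have := ht.2; have : 0 ≤ 1 - t := by linarith
                                     positivity
    nlinarith
  constructor <;> linarith

lemma tendsto_cylRadius (hx : x ∈ unitIrrational) :
    Tendsto (cylRadius x) atTop (𝓝[>] 0) := by
  have hpos : ∀ n, 0 < cylRadius x n ∧ cylRadius x n ≤ 1 / ((n : ℝ) + 1) := by
    intro n
    have hq : (1 : ℝ) ≤ qden x (n + 1) := by exact_mod_cast (qden_nonneg_and_one_le hx n).2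
    have hq' : (0 : ℝ) ≤ qden x n := by exact_mod_cast (qden_nonneg_and_one_le hx n).1
    have hn : (n : ℝ) ≤ qden x (n + 1) := by exact_mod_cast natCast_le_qden hx n
    refine ⟨by unfold cylRadius; positivity, ?_⟩
    rw [cylRadius, div_div]
    exact one_div_le_one_div_of_le (by positivity) (by nlinarith)
  exact tendsto_nhdsWithin_iff.2 ⟨squeeze_zero (fun n => (hpos n).1.le) (fun n => (hpos n).2)
    tendsto_one_div_add_atTop_nhds_zero_nat, Eventually.of_forall fun n => (hpos n).1⟩

lemma volume_mul_le_volume_image_cylMap (hx : x ∈ unitIrrational) (n : ℕ) {A : Set ℝ}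
    (hA : MeasurableSet A) (hAJ : A ⊆ unitIrrational) :
    volume A / 4 * volume (Metric.closedBall (cylCenter x n) (cylRadius x n)) ≤
      volume (cylMap x n '' A) := by
  have hq : (1 : ℝ) ≤ qden x (n + 1) := by exact_mod_cast (qden_nonneg_and_one_le hx n).2
  have hq' : (0 : ℝ) ≤ qden x n := by exact_mod_cast (qden_nonneg_and_one_le hx n).1
  have hqq : (qden x n : ℝ) ≤ qden x (n + 1) := by exact_mod_cast qden_le_succ hx n
  have h := lintegral_image_eq_lintegral_abs_deriv_mul hA
    (fun t ht => (hasDerivAt_cylMap hx n (hAJ ht).1.1.le).hasDerivWithinAt)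
    ((injOn_cylMap hx n).mono hAJ) (fun _ => 1)
  simp only [lintegral_const, Measure.restrict_apply_univ, one_mul, mul_one] at h
  rw [h, Real.volume_closedBall]
  calc volume A / 4 * ENNReal.ofReal (2 * cylRadius x n)
      = ∫⁻ t in A, ENNReal.ofReal (2 * cylRadius x n / 4) := by
        rw [lintegral_const, Measure.restrict_apply_univ, ENNReal.ofReal_div_of_pos (by norm_num),
          ENNReal.ofReal_ofNat, div_eq_mul_inv, div_eq_mul_inv]
        ring
    _ ≤ _ := by
        refine setLIntegral_mono' hA fun t ht => ENNReal.ofReal_le_ofReal ?_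
        have ht := (hAJ ht).1
        have hd := qden_add_pos hx n ht.1.le
        have ht0 := ht.1
        rw [abs_div, abs_pow, abs_neg, abs_one, one_pow, abs_of_pos (by positivity), cylRadius,
          mul_div_cancel₀ _ two_ne_zero, div_div]
        refine one_div_le_one_div_of_le (by positivity) ?_
        have h1 : (qden x (n + 1) : ℝ) + t * qden x n ≤ 2 * qden x (n + 1) := by
          have := mul_le_of_le_one_left hq' ht.2.le
          linarith
        calc ((qden x (n + 1) : ℝ) + t * qden x n) ^ 2 ≤ (2 * qden x (n + 1)) ^ 2 := by gcongr
          _ ≤ _ := by nlinarith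

/-- Ergodicity of the Gauss map with respect to Lebesgue measure. -/
theorem ae_mem_of_gaussMap_backward_invariant {E : Set ℝ} (hEm : MeasurableSet E)
    (hE : ∀ x ∈ unitIrrational, gaussMap x ∈ E → x ∈ E)
    (hpos : volume (E ∩ unitIrrational) ≠ 0) : ∀ᵐ x : ℝ, x ∈ unitIrrational → x ∈ E := by
  have hJ := measurableSet_unitIrrational
  set F := unitIrrational \ E with hF
  have hFm : MeasurableSet F := hJ.diff hEm
  have hd := IsUnifLocDoublingMeasure.ae_tendsto_measure_inter_div (volume : Measure ℝ) F 1
  rw [ae_restrict_iff' hFm] at hd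
  filter_upwards [hd] with x hxd hx
  by_contra hxE
  have hlim := hxd ⟨hx, hxE⟩ (cylCenter x) (cylRadius x) (tendsto_cylRadius hx)
    (Eventually.of_forall fun n => by
      rw [one_mul]
      have := cylMap_mem_closedBall hx n (t := gaussMap^[n] x)
        ⟨(iterate_gaussMap_mem hx n).1.1.le, (iterate_gaussMap_mem hx n).1.2.le⟩
      rwa [cylMap_iterate hx n] at this)
  have hle : ∀ n, volume (F ∩ Metric.closedBall (cylCenter x n) (cylRadius x n)) /
      volume (Metric.closedBall (cylCenter x n) (cylRadius x n)) +
        volume (E ∩ unitIrrational) / 4 ≤ 1 := by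
    intro n
    set B := Metric.closedBall (cylCenter x n) (cylRadius x n)
    have hr : 0 < cylRadius x n := by
      have hq : (1 : ℝ) ≤ qden x (n + 1) := by exact_mod_cast (qden_nonneg_and_one_le hx n).2
      have hq' : (0 : ℝ) ≤ qden x n := by exact_mod_cast (qden_nonneg_and_one_le hx n).1
      unfold cylRadius; positivity
    have hB0 : volume B ≠ 0 := by
      rw [Real.volume_closedBall]; simpa using hr
    have hBt : volume B ≠ ⊤ := by
      rw [Real.volume_closedBall]; exact ENNReal.ofReal_ne_top
    have h1 := volume_mul_le_volume_image_cylMap hx n (hEm.inter hJ) Set.inter_subset_right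
    have hsub : cylMap x n '' (E ∩ unitIrrational) ⊆ B \ (F ∩ B) := by
      rintro _ ⟨t, ⟨htE, htJ⟩, rfl⟩
      have h2 := cylMap_mem_and_iterate_cylMap hx n htJ
      refine ⟨cylMap_mem_closedBall hx n ⟨htJ.1.1.le, htJ.1.2.le⟩, fun h3 => h3.1.2 ?_⟩
      exact mem_of_iterate_gaussMap_mem hE n h2.1 (by rwa [h2.2])
    have h3 : volume (F ∩ B) + volume (E ∩ unitIrrational) / 4 * volume B ≤ volume B := by
      calc _ ≤ volume (F ∩ B) + volume (B \ (F ∩ B)) := by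
            gcongr; exact h1.trans (measure_mono hsub)
        _ = volume B := by
            rw [measure_add_sdiff
              (hFm.inter Metric.isClosed_closedBall.measurableSet).nullMeasurableSet,
              Set.union_eq_self_of_subset_left Set.inter_subset_right]
    calc _ = (volume (F ∩ B) + volume (E ∩ unitIrrational) / 4 * volume B) / volume B := by
          rw [ENNReal.add_div, ENNReal.mul_div_cancel_right hB0 hBt]
      _ ≤ 1 := ENNReal.div_le_of_le_mul (by rwa [one_mul])
  have h4 := le_of_tendsto' (hlim.add_const (volume (E ∩ unitIrrational) / 4)) hle
  have h5 : volume (E ∩ unitIrrational) / 4 ≤ 0 :=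
    (ENNReal.add_le_add_iff_left ENNReal.one_ne_top).1 (by rwa [add_zero])
  rw [nonpos_iff_eq_zero, ENNReal.div_eq_zero_iff] at h5
  rcases h5 with h5 | h5
  · exact hpos h5
  · exact absurd h5 (by norm_num)

end Cylinders

/-- The invariant measure of `gaussNE`, up to normalisation. -/
noncomputable def gaussNEMeasure : Measure (ℝ × ℝ) :=
  (volume.restrict (unitIrrational ×ˢ unitIrrational)).withDensity
    fun p => ENNReal.ofReal (1 / (1 + p.1 * p.2) ^ 2)

/-- The irrational points of `(0, 1)` whose first partial quotient is `m`. -/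
def digitSet (m : ℤ) : Set ℝ := {t | t ∈ unitIrrational ∧ ⌊1 / t⌋ = m}

section NaturalExtension

lemma measurable_floor_one_div : Measurable fun t : ℝ => ⌊1 / t⌋ :=
  Int.measurable_floor.comp (measurable_const.div measurable_id)

lemma measurable_gaussMap : Measurable gaussMap :=
  measurable_fract.comp (measurable_const.div measurable_id)

lemma measurable_gaussNE : Measurable gaussNE := by
  refine (measurable_gaussMap.comp measurable_fst).prodMk
    (measurable_const.div (.add ?_ measurable_snd))
  exact (measurable_from_top (f := fun n : ℤ => (n : ℝ))).comp
    (measurable_floor_one_div.comp measurable_fst)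

lemma measurableSet_digitSet (m : ℤ) : MeasurableSet (digitSet m) :=
  measurableSet_unitIrrational.inter (measurable_floor_one_div (measurableSet_singleton m))

lemma measurable_gaussDensity :
    Measurable fun p : ℝ × ℝ => ENNReal.ofReal (1 / (1 + p.1 * p.2) ^ 2) := by
  fun_prop

lemma pairwise_disjoint_digitSet :
    Pairwise (Function.onFun Disjoint fun m : ℕ => digitSet ((m : ℤ) + 1)) := by
  intro m n hmn
  refine Set.disjoint_left.2 fun t h1 h2 => hmn ?_
  have := h1.2.symm.trans h2.2
  lia

lemma iUnion_digitSet : ⋃ m : ℕ, digitSet ((m : ℤ) + 1) = unitIrrational := by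
  ext t
  simp only [Set.mem_iUnion]
  refine ⟨fun ⟨_, h⟩ => h.1, fun h => ⟨(⌊1 / t⌋ - 1).toNat, h, ?_⟩⟩
  have := one_le_floor_one_div h
  lia

lemma gaussNE_image (m : ℕ) :
    (Prod.map (fun t : ℝ => 1 / t - ((m : ℝ) + 1)) (fun v : ℝ => 1 / (((m : ℝ) + 1) + v))) ''
      (digitSet ((m : ℤ) + 1) ×ˢ unitIrrational) = unitIrrational ×ˢ digitSet ((m : ℤ) + 1) := by
  have hm : (1 : ℤ) ≤ (m : ℤ) + 1 := by lia
  rw [Set.prodMap_image_prod]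
  congr 1
  · ext s
    constructor
    · rintro ⟨t, ht, rfl⟩
      have h1 := one_div_eq_floor_add_gaussMap t
      rw [ht.2] at h1
      push_cast at h1
      have : 1 / t - ((m : ℝ) + 1) = gaussMap t := by linarith
      simp only [this]
      exact gaussMap_mem ht.1
    · intro hs
      have h1 := one_div_intCast_add_mem hs hm
      have h2 := floor_one_div_one_div_add ⟨hs.1.1.le, hs.1.2⟩ ((m : ℤ) + 1)
      refine ⟨_, ⟨h1, h2⟩, ?_⟩
      simp only [one_div_one_div]
      push_cast; ring
  · ext s
    constructor
    · rintro ⟨t, ht, rfl⟩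
      have h1 := one_div_intCast_add_mem ht hm
      have h2 := floor_one_div_one_div_add ⟨ht.1.1.le, ht.1.2⟩ ((m : ℤ) + 1)
      push_cast at h1 h2
      exact ⟨h1, h2⟩
    · intro hs
      refine ⟨gaussMap s, gaussMap_mem hs.1, ?_⟩
      have h1 := one_div_eq_floor_add_gaussMap s
      rw [hs.2] at h1
      push_cast at h1
      simp only [← h1, one_div_one_div]

lemma setLIntegral_digitSet (m : ℕ) (B : Set (ℝ × ℝ)) :
    ∫⁻ p in digitSet ((m : ℤ) + 1) ×ˢ unitIrrational,
      (gaussNE ⁻¹' B).indicator (fun p => ENNReal.ofReal (1 / (1 + p.1 * p.2) ^ 2)) p =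
    ∫⁻ p in unitIrrational ×ˢ digitSet ((m : ℤ) + 1),
      B.indicator (fun p => ENNReal.ofReal (1 / (1 + p.1 * p.2) ^ 2)) p := by
  have hs : MeasurableSet (digitSet ((m : ℤ) + 1) ×ˢ unitIrrational) :=
    (measurableSet_digitSet _).prod measurableSet_unitIrrational
  have hder : ∀ p ∈ digitSet ((m : ℤ) + 1) ×ˢ unitIrrational,
      HasFDerivWithinAt
        (Prod.map (fun t : ℝ => 1 / t - ((m : ℝ) + 1)) (fun v : ℝ => 1 / (((m : ℝ) + 1) + v)))
        (((ContinuousLinearMap.toSpanSingleton ℝ (-1 / p.1 ^ 2)).prodMap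
          (ContinuousLinearMap.toSpanSingleton ℝ (-1 / (((m : ℝ) + 1) + p.2) ^ 2))))
        (digitSet ((m : ℤ) + 1) ×ˢ unitIrrational) p := by
    intro p hp
    have h1 := hp.1.1.1.1
    have h2 := hp.2.1.1
    refine HasFDerivAt.hasFDerivWithinAt (HasFDerivAt.prodMap p ?_ ?_)
    · refine HasDerivAt.hasFDerivAt ?_
      have := ((hasDerivAt_id p.1).inv h1.ne').sub_const ((m : ℝ) + 1)
      simpa [one_div] using this
    · refine HasDerivAt.hasFDerivAt ?_
      have := ((hasDerivAt_id p.2).const_add ((m : ℝ) + 1)).inv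
        (by simp only [id]; positivity)
      simp only [one_div]
      exact this
  have hinj : Set.InjOn
      (Prod.map (fun t : ℝ => 1 / t - ((m : ℝ) + 1)) (fun v : ℝ => 1 / (((m : ℝ) + 1) + v)))
      (digitSet ((m : ℤ) + 1) ×ˢ unitIrrational) := by
    rintro p - q - h
    simp only [Prod.map, Prod.mk.injEq, sub_left_inj, one_div, inv_inj, add_right_inj] at h
    exact Prod.ext h.1 h.2
  have key := lintegral_image_eq_lintegral_abs_det_fderiv_mul volume hs hder hinj
    (B.indicator (fun p => ENNReal.ofReal (1 / (1 + p.1 * p.2) ^ 2)))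
  rw [gaussNE_image] at key
  rw [key]
  refine setLIntegral_congr_fun hs fun p hp => ?_
  have h1 := hp.1.1.1.1
  have h2 := hp.2.1.1
  have hfl : (⌊1 / p.1⌋ : ℝ) = (m : ℝ) + 1 := by rw [hp.1.2]; push_cast; ring
  have hG : Prod.map (fun t : ℝ => 1 / t - ((m : ℝ) + 1)) (fun v : ℝ => 1 / (((m : ℝ) + 1) + v)) p
      = gaussNE p := by
    have h3 := one_div_eq_floor_add_gaussMap p.1
    rw [hfl] at h3
    refine Prod.ext ?_ ?_
    · simp only [Prod.map, gaussNE]; linarith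
    · simp only [Prod.map, gaussNE, hfl]
  have hdet : ((ContinuousLinearMap.toSpanSingleton ℝ (-1 / p.1 ^ 2)).prodMap
          (ContinuousLinearMap.toSpanSingleton ℝ (-1 / (((m : ℝ) + 1) + p.2) ^ 2))).det =
          (-1 / p.1 ^ 2) * (-1 / (((m : ℝ) + 1) + p.2) ^ 2) := by
    rw [ContinuousLinearMap.det, ContinuousLinearMap.coe_prodMap, LinearMap.det_prodMap,
      LinearMap.det_ring, LinearMap.det_ring]
    simp
  rw [hG, hdet]
  by_cases hb : gaussNE p ∈ B
  · rw [Set.indicator_of_mem hb, Set.indicator_of_mem (by exact hb),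
      ← ENNReal.ofReal_mul (abs_nonneg _), ← hG]
    congr 1
    have hm : (0 : ℝ) < (m : ℝ) + 1 := by positivity
    simp only [Prod.map]
    have e : 1 + (1 / p.1 - ((m : ℝ) + 1)) * (1 / ((m : ℝ) + 1 + p.2))
        = (1 + p.1 * p.2) / (p.1 * ((m : ℝ) + 1 + p.2)) := by
      field_simp; ring
    rw [e, abs_of_nonneg]
    · have : 0 < 1 + p.1 * p.2 := by positivity
      field_simp
    · rw [div_mul_div_comm]; norm_num; positivity
  · rw [Set.indicator_of_notMem hb, Set.indicator_of_notMem (by exact hb), mul_zero]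

lemma gaussNEMeasure_apply {B : Set (ℝ × ℝ)} (hB : MeasurableSet B) :
    gaussNEMeasure B = ∫⁻ p in unitIrrational ×ˢ unitIrrational,
      B.indicator (fun p => ENNReal.ofReal (1 / (1 + p.1 * p.2) ^ 2)) p := by
  rw [gaussNEMeasure, withDensity_apply _ hB, lintegral_indicator hB]

theorem measurePreserving_gaussNE : MeasurePreserving gaussNE gaussNEMeasure gaussNEMeasure := by
  refine ⟨measurable_gaussNE, Measure.ext fun B hB => ?_⟩
  have hJ := measurableSet_unitIrrational
  rw [Measure.map_apply measurable_gaussNE hB, gaussNEMeasure_apply (measurable_gaussNE hB),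
    gaussNEMeasure_apply hB]
  have e1 : unitIrrational ×ˢ unitIrrational =
      ⋃ m : ℕ, digitSet ((m : ℤ) + 1) ×ˢ unitIrrational := by
    rw [← Set.iUnion_prod_const, iUnion_digitSet]
  have e2 : unitIrrational ×ˢ unitIrrational =
      ⋃ m : ℕ, unitIrrational ×ˢ digitSet ((m : ℤ) + 1) := by
    rw [← Set.prod_iUnion, iUnion_digitSet]
  calc _ = ∑' m : ℕ, ∫⁻ p in digitSet ((m : ℤ) + 1) ×ˢ unitIrrational,
        (gaussNE ⁻¹' B).indicator (fun p => ENNReal.ofReal (1 / (1 + p.1 * p.2) ^ 2)) p := by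
        rw [e1, lintegral_iUnion (fun m => (measurableSet_digitSet _).prod hJ)]
        exact fun m n hmn => Set.disjoint_prod.2 (.inl (pairwise_disjoint_digitSet hmn))
    _ = ∑' m : ℕ, ∫⁻ p in unitIrrational ×ˢ digitSet ((m : ℤ) + 1),
        B.indicator (fun p => ENNReal.ofReal (1 / (1 + p.1 * p.2) ^ 2)) p := by
        simp_rw [setLIntegral_digitSet]
    _ = _ := by
        rw [e2, lintegral_iUnion (fun m => hJ.prod (measurableSet_digitSet _))]
        exact fun m n hmn => Set.disjoint_prod.2 (.inr (pairwise_disjoint_digitSet hmn))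

instance : IsFiniteMeasure gaussNEMeasure := by
  refine ⟨?_⟩
  rw [gaussNEMeasure_apply MeasurableSet.univ, Set.indicator_univ]
  have hJ := measurableSet_unitIrrational
  calc _ ≤ ∫⁻ p in unitIrrational ×ˢ unitIrrational, 1 := by
        refine setLIntegral_mono' (hJ.prod hJ) fun p hp => ?_
        rw [ENNReal.ofReal_le_one]
        have h1 := hp.1.1.1
        have h2 := hp.2.1.1
        have := mul_pos h1 h2
        rw [div_le_one (by positivity)]
        nlinarith
    _ < ⊤ := by
        rw [setLIntegral_one, Measure.volume_eq_prod, Measure.prod_prod, volume_unitIrrational]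
        norm_num

lemma ae_gaussNEMeasure_mem :
    ∀ᵐ p ∂gaussNEMeasure, p ∈ unitIrrational ×ˢ unitIrrational :=
  (withDensity_absolutelyContinuous _ _).ae_le
    (ae_restrict_mem (measurableSet_unitIrrational.prod measurableSet_unitIrrational))

lemma ae_gaussNEMeasure_of_ae {P : ℝ → Prop} (h : ∀ᵐ x : ℝ, P x) :
    ∀ᵐ p ∂gaussNEMeasure, P p.1 :=
  ((withDensity_absolutelyContinuous _ _).trans Measure.absolutelyContinuous_restrict).ae_le
    (Measure.quasiMeasurePreserving_fst.ae h)

end NaturalExtension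

lemma exists_rat_frequently_of_tendsto_sub {u w : ℕ → ℝ} {c : ℝ}
    (h : Tendsto (fun n => u n - w n) atTop (𝓝 0))
    (hu : ∃ q : ℚ, c < q ∧ ∃ᶠ n in atTop, (q : ℝ) < u n) :
    ∃ q : ℚ, c < q ∧ ∃ᶠ n in atTop, (q : ℝ) < w n := by
  obtain ⟨q, hq, hf⟩ := hu
  obtain ⟨r, hr1, hr2⟩ := exists_rat_btwn hq
  refine ⟨r, hr1, ?_⟩
  have he : ∀ᶠ n in atTop, u n - w n < q - r := h.eventually_lt_const (by linarith)
  exact (hf.and_eventually he).mono fun n hn => by linarith [hn.1, hn.2]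

section Birkhoff

variable {f : ℝ × ℝ → ℝ} {K C : ℝ}

lemma tendsto_birkhoffAverage_gaussNE_sub
    (hK : ∀ t ∈ unitIrrational, ∀ v ∈ Set.Icc (0 : ℝ) 1, ∀ w ∈ Set.Icc (0 : ℝ) 1,
      |f (t, v) - f (t, w)| ≤ K * |v - w|)
    {x v w : ℝ} (hx : x ∈ unitIrrational) (hv : v ∈ Set.Icc (0 : ℝ) 1)
    (hw : w ∈ Set.Icc (0 : ℝ) 1) :
    Tendsto (fun N => birkhoffAverage ℝ gaussNE f N (x, v) - birkhoffAverage ℝ gaussNE f N (x, w))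
      atTop (𝓝 0) := by
  have hK0 : 0 ≤ K := by
    have := (abs_nonneg _).trans (hK x hx 1 (by simp) 0 (by simp))
    simpa using this
  have h0 : Tendsto (fun n => f (gaussNE^[n] (x, v)) - f (gaussNE^[n] (x, w))) atTop (𝓝 0) := by
    have hlim : Tendsto (fun n : ℕ => K * (2 * (1 / 2 : ℝ) ^ n)) atTop (𝓝 0) := by
      have := ((tendsto_pow_atTop_nhds_zero_of_lt_one (r := (1 / 2 : ℝ)) (by norm_num)
        (by norm_num)).const_mul 2).const_mul K
      simpa using this
    refine squeeze_zero_norm (fun n => ?_) hlim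
    have h1 : gaussNE^[n] (x, v) = (gaussMap^[n] x, (gaussNE^[n] (x, v)).2) :=
      Prod.ext (iterate_gaussNE_fst _ _) rfl
    have h2 : gaussNE^[n] (x, w) = (gaussMap^[n] x, (gaussNE^[n] (x, w)).2) :=
      Prod.ext (iterate_gaussNE_fst _ _) rfl
    rw [Real.norm_eq_abs, h1, h2]
    exact (hK _ (iterate_gaussMap_mem hx n) _ (iterate_gaussNE_snd_mem hx hv n) _
      (iterate_gaussNE_snd_mem hx hw n)).trans
      (mul_le_mul_of_nonneg_left (abs_iterate_gaussNE_snd_sub_le hx hv hw n) hK0)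
  refine h0.cesaro.congr fun N => ?_
  rw [birkhoffAverage, birkhoffAverage, birkhoffSum, birkhoffSum, Finset.sum_sub_distrib,
    smul_eq_mul, smul_eq_mul, mul_sub]

/-- The points over which the limit superior of the Birkhoff averages exceeds `c`. -/
def upperBirkhoffSet (f : ℝ × ℝ → ℝ) (c : ℝ) : Set ℝ :=
  {x | ∃ q : ℚ, c < q ∧ ∃ᶠ N in atTop, (q : ℝ) < birkhoffAverage ℝ gaussNE f N (x, 0)}

lemma measurableSet_upperBirkhoffSet (hf : Measurable f) (c : ℝ) :
    MeasurableSet (upperBirkhoffSet f c) := by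
  have hm : ∀ N, Measurable fun x : ℝ => birkhoffAverage ℝ gaussNE f N (x, 0) := fun N => by
    simp only [birkhoffAverage, birkhoffSum]
    have hk : Measurable fun x : ℝ => ∑ k ∈ Finset.range N, f (gaussNE^[k] (x, 0)) :=
      Finset.measurable_sum _ fun k _ =>
        hf.comp ((measurable_gaussNE.iterate k).comp (measurable_id.prodMk measurable_const))
    exact hk.const_smul (N : ℝ)⁻¹
  simp only [upperBirkhoffSet, frequently_atTop, Set.ofPred_exists, Set.ofPred_and,
    Set.ofPred_forall]
  refine .iUnion fun q => .inter (.const _) (.iInter fun n => .iUnion fun m => ?_)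
  exact .inter (.const _) (measurableSet_lt measurable_const (hm m))

lemma mem_upperBirkhoffSet_of_gaussMap_mem (hC : ∀ p, |f p| ≤ C)
    (hK : ∀ t ∈ unitIrrational, ∀ v ∈ Set.Icc (0 : ℝ) 1, ∀ w ∈ Set.Icc (0 : ℝ) 1,
      |f (t, v) - f (t, w)| ≤ K * |v - w|) {c : ℝ} :
    ∀ x ∈ unitIrrational, gaussMap x ∈ upperBirkhoffSet f c → x ∈ upperBirkhoffSet f c := by
  intro x hx h
  have h1 : gaussNE (x, 0) = (gaussMap x, (gaussNE^[1] (x, 0)).2) := rfl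
  have h2 := tendsto_birkhoffAverage_gaussNE_sub hK (gaussMap_mem hx)
    (show (0 : ℝ) ∈ Set.Icc 0 1 by simp) (iterate_gaussNE_snd_mem hx (v := 0) (by simp) 1)
  have h3 := tendsto_birkhoffAverage_apply_sub_birkhoffAverage ℝ (f := gaussNE) (g := f)
    (x := (x, 0)) (isBounded_iff_forall_norm_le.2 ⟨C, by rintro _ ⟨n, rfl⟩; exact hC _⟩)
  rw [h1] at h3
  exact exists_rat_frequently_of_tendsto_sub h3 (exists_rat_frequently_of_tendsto_sub h2 h)

lemma ae_notMem_upperBirkhoffSet (hf : Measurable f) (hC : ∀ p, |f p| ≤ C)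
    (hK : ∀ t ∈ unitIrrational, ∀ v ∈ Set.Icc (0 : ℝ) 1, ∀ w ∈ Set.Icc (0 : ℝ) 1,
      |f (t, v) - f (t, w)| ≤ K * |v - w|) {c : ℝ}
    (hc : ∫ p, f p ∂gaussNEMeasure < c * gaussNEMeasure.real Set.univ) :
    ∀ᵐ x : ℝ, x ∈ unitIrrational → x ∉ upperBirkhoffSet f c := by
  by_cases hpos : volume (upperBirkhoffSet f c ∩ unitIrrational) = 0
  · filter_upwards [compl_mem_ae_iff.2 hpos] with x hx hxJ hxE using hx ⟨hxE, hxJ⟩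
  · exfalso
    have hae := ae_gaussNEMeasure_of_ae (ae_mem_of_gaussMap_backward_invariant
      (measurableSet_upperBirkhoffSet hf c) (mem_upperBirkhoffSet_of_gaussMap_mem hC hK) hpos)
    have hfi : Integrable f gaussNEMeasure :=
      .of_bound hf.aestronglyMeasurable C (.of_forall hC)
    have hci : Integrable (fun _ : ℝ × ℝ => c) gaussNEMeasure := integrable_const c
    have h0 := integral_nonneg_of_ae_exists_birkhoffSum_pos (g := fun p => f p - c)
      measurePreserving_gaussNE (hf.sub_const c) (hfi.sub hci) ?_
    · rw [integral_sub hfi hci, integral_const, smul_eq_mul] at h0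
      linarith
    filter_upwards [hae, ae_gaussNEMeasure_mem] with p hp hpJ
    obtain ⟨q, hq, hfr⟩ := exists_rat_frequently_of_tendsto_sub
      (tendsto_birkhoffAverage_gaussNE_sub hK hpJ.1 (show (0 : ℝ) ∈ Set.Icc 0 1 by simp)
        ⟨hpJ.2.1.1.le, hpJ.2.1.2.le⟩) (hp hpJ.1)
    obtain ⟨N, hN, hN0⟩ := (hfr.and_eventually (eventually_gt_atTop 0)).exists
    refine ⟨N, ?_⟩
    have hN' : (0 : ℝ) < N := by exact_mod_cast hN0
    rw [birkhoffAverage, smul_eq_mul, ← div_eq_inv_mul, lt_div_iff₀ hN'] at hN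
    rw [birkhoffSum, Finset.sum_sub_distrib, Finset.sum_const, Finset.card_range, nsmul_eq_mul]
    have : c * N ≤ q * N := by gcongr
    rw [birkhoffSum] at hN
    linarith

lemma gaussNEMeasure_univ_pos : 0 < gaussNEMeasure.real Set.univ := by
  rw [measureReal_def, ENNReal.toReal_pos_iff]
  refine ⟨?_, measure_lt_top _ _⟩
  rw [pos_iff_ne_zero, gaussNEMeasure_apply MeasurableSet.univ, Set.indicator_univ]
  intro h
  have hJ := measurableSet_unitIrrational
  rw [lintegral_eq_zero_iff (by fun_prop)] at h
  have h2 : ∀ᵐ p ∂((volume : Measure (ℝ × ℝ)).restrict (unitIrrational ×ˢ unitIrrational)),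
      False := by
    filter_upwards [h, ae_restrict_mem (hJ.prod hJ)] with p hp hpJ
    have h1 := mul_pos hpJ.1.1.1 hpJ.2.1.1
    simp only [Pi.zero_apply, ENNReal.ofReal_eq_zero] at hp
    exact absurd hp (not_le.2 (by positivity))
  rw [eventually_false_iff_eq_bot, ae_eq_bot, Measure.restrict_eq_zero, Measure.volume_eq_prod,
    Measure.prod_prod, volume_unitIrrational] at h2
  norm_num at h2

/-- The pointwise ergodic theorem along the `gaussNE`-orbits of the points `(x, 0)`, for
functions which are Lipschitz in the second coordinate. -/
theorem ae_tendsto_birkhoffAverage_gaussNE (hf : Measurable f) (hC : ∀ p, |f p| ≤ C)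
    (hK : ∀ t ∈ unitIrrational, ∀ v ∈ Set.Icc (0 : ℝ) 1, ∀ w ∈ Set.Icc (0 : ℝ) 1,
      |f (t, v) - f (t, w)| ≤ K * |v - w|) :
    ∀ᵐ x : ℝ, x ∈ unitIrrational →
      Tendsto (fun N => birkhoffAverage ℝ gaussNE f N (x, 0)) atTop
        (𝓝 ((∫ p, f p ∂gaussNEMeasure) / gaussNEMeasure.real Set.univ)) := by
  have hu := gaussNEMeasure_univ_pos
  set M := (∫ p, f p ∂gaussNEMeasure) / gaussNEMeasure.real Set.univ with hM
  have hup : ∀ᵐ x : ℝ, ∀ q : ℚ, M < q → x ∈ unitIrrational → x ∉ upperBirkhoffSet f q := by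
    rw [ae_all_iff]
    intro q
    by_cases hq : M < q
    · have := ae_notMem_upperBirkhoffSet hf hC hK (c := q) ((div_lt_iff₀ hu).1 hq)
      filter_upwards [this] with x hx _ using hx
    · exact .of_forall fun x h => absurd h hq
  have hlow : ∀ᵐ x : ℝ, ∀ q : ℚ, -M < q → x ∈ unitIrrational →
      x ∉ upperBirkhoffSet (fun p => -f p) q := by
    rw [ae_all_iff]
    intro q
    by_cases hq : -M < q
    · have := ae_notMem_upperBirkhoffSet (f := fun p => -f p) (C := C) (K := K) hf.neg
        (fun p => by rw [abs_neg]; exact hC p)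
        (fun t ht v hv w hw => by
          rw [← abs_neg]
          have := hK t ht v hv w hw
          rwa [show -(-f (t, v) - -f (t, w)) = f (t, v) - f (t, w) by ring])
        (c := q) (by
          rw [integral_neg]
          refine (div_lt_iff₀ hu).1 ?_
          rwa [neg_div, ← hM])
      filter_upwards [this] with x hx _ using hx
    · exact .of_forall fun x h => absurd h hq
  filter_upwards [hup, hlow] with x h1 h2 hx
  refine tendsto_order.2 ⟨fun a ha => ?_, fun a ha => ?_⟩
  · obtain ⟨q, hq1, hq2⟩ := exists_rat_btwn (neg_lt_neg ha)
    obtain ⟨r, hr1, hr2⟩ := exists_rat_btwn hq2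
    have h3 := h2 q hq1 hx
    simp only [upperBirkhoffSet, Set.mem_ofPred_eq, not_exists, not_and, not_frequently] at h3
    filter_upwards [h3 r hr1] with N hN
    rw [birkhoffAverage, birkhoffSum] at hN ⊢
    rw [Finset.sum_neg_distrib, smul_neg] at hN
    linarith
  · obtain ⟨q, hq1, hq2⟩ := exists_rat_btwn ha
    obtain ⟨r, hr1, hr2⟩ := exists_rat_btwn hq2
    have h3 := h1 q hq1 hx
    simp only [upperBirkhoffSet, Set.mem_ofPred_eq, not_exists, not_and, not_frequently] at h3
    filter_upwards [h3 r hr1] with N hN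
    linarith

end Birkhoff

/-- The points over which the first partial quotient is `a` and `medThetaNE l` is at most `z`. -/
def medSublevel (a l : ℕ) (z : ℝ) : Set (ℝ × ℝ) :=
  {p | p ∈ digitSet a ×ˢ unitIrrational ∧ medThetaNE l p ≤ z}

/-- The length of the fibre of `medSublevel a l z` over `t`, measured with density
`1 / (1 + t * v) ^ 2`. -/
noncomputable def medFibre (l z t : ℝ) : ℝ :=
  max 0 (min ((z - l * (1 - l * t)) / (1 - l * t) ^ 2) (1 / (1 + t)))

section Fibres

variable {l z t : ℝ}

lemma medThetaNE_le_iff {v : ℝ} (ht : 0 < t) (hl : 0 < 1 - l * t) (hv : 0 < v) :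
    medThetaNE l (t, v) ≤ z ↔ v / (1 + t * v) ≤ (z - l * (1 - l * t)) / (1 - l * t) ^ 2 := by
  have h1 : 0 < 1 + t * v := by positivity
  have e : medThetaNE l (t, v) = l * (1 - l * t) + v / (1 + t * v) * (1 - l * t) ^ 2 := by
    simp only [medThetaNE]; field_simp; ring
  rw [e, le_div_iff₀ (by positivity)]
  constructor <;> intro h <;> linarith

lemma div_one_add_mul_le_iff {v w : ℝ} (ht : 0 < t) (hv : 0 ≤ v) (hw : 0 ≤ w) :
    v / (1 + t * v) ≤ w / (1 + t * w) ↔ v ≤ w := by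
  rw [div_le_div_iff₀ (by positivity) (by positivity)]
  constructor <;> intro h <;> nlinarith

lemma exists_fibre_endpoint (ht : 0 < t) (hl : 0 < 1 - l * t) (z : ℝ) :
    ∃ w ∈ Set.Icc (0 : ℝ) 1, w / (1 + t * w) = medFibre l z t ∧
      ∀ v ∈ Set.Ioo (0 : ℝ) 1, medThetaNE l (t, v) ≤ z ↔ v ≤ w := by
  unfold medFibre
  set y := (z - l * (1 - l * t)) / (1 - l * t) ^ 2 with hy
  rcases le_total y 0 with h0 | h0
  · refine ⟨0, by simp, ?_, fun v hv => ?_⟩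
    · rw [max_eq_left ((min_le_left _ _).trans h0)]; simp
    · rw [medThetaNE_le_iff ht hl hv.1, ← hy]
      have hv0 := hv.1
      have : 0 < v / (1 + t * v) := by positivity
      exact ⟨fun h => by linarith, fun h => by linarith⟩
  rcases le_total (1 / (1 + t)) y with h1 | h1
  · refine ⟨1, by simp, ?_, fun v hv => ?_⟩
    · rw [min_eq_right h1, max_eq_right (by positivity), mul_one]
    · rw [medThetaNE_le_iff ht hl hv.1, ← hy]
      refine iff_of_true (le_trans ?_ h1) hv.2.le
      have := (div_one_add_mul_le_iff ht hv.1.le zero_le_one).2 hv.2.le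
      rwa [mul_one] at this
  · have h2 : y * (1 + t) ≤ 1 := (le_div_iff₀ (by positivity)).1 h1
    have h3 : 0 < 1 - t * y := by
      have : t * (y * (1 + t)) ≤ t * 1 := by gcongr
      nlinarith
    have e : y / (1 - t * y) / (1 + t * (y / (1 - t * y))) = y := by
      have e1 : 1 + t * (y / (1 - t * y)) = 1 / (1 - t * y) := by
        rw [eq_div_iff h3.ne']
        field_simp
        ring
      rw [e1, div_div_div_cancel_right₀ h3.ne', div_one]
    have hw0 : 0 ≤ y / (1 - t * y) := by positivity
    refine ⟨y / (1 - t * y), ⟨hw0, ?_⟩, ?_, fun v hv => ?_⟩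
    · rw [div_le_one h3]; linarith
    · rw [min_eq_left h1, max_eq_right h0, e]
    · rw [medThetaNE_le_iff ht hl hv.1, ← hy, ← div_one_add_mul_le_iff ht hv.1.le hw0, e]

lemma integral_one_div_one_add_mul_sq {w : ℝ} (ht : 0 < t) (hw : 0 ≤ w) :
    ∫ v in (0 : ℝ)..w, 1 / (1 + t * v) ^ 2 = w / (1 + t * w) := by
  have hpos : ∀ v ∈ Set.uIcc 0 w, 0 < 1 + t * v := by
    intro v hv
    rw [Set.uIcc_of_le hw] at hv
    have := hv.1
    positivity
  rw [intervalIntegral.integral_eq_sub_of_hasDerivAt (f := fun v => v / (1 + t * v))]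
  · simp
  · intro v hv
    have h := (hasDerivAt_id v).div (((hasDerivAt_id v).const_mul t).const_add 1) (hpos v hv).ne'
    refine h.congr_deriv ?_
    simp only [id]
    congr 1
    ring
  · refine ContinuousOn.intervalIntegrable ?_
    exact continuousOn_const.div (by fun_prop) fun v hv => (pow_pos (hpos v hv) 2).ne'

lemma unitIrrational_ae_eq : unitIrrational =ᵐ[volume] Set.Ioo (0 : ℝ) 1 := by
  filter_upwards [ae_mem_unitIrrational] with x hx
  exact propext ⟨fun h => h.1, hx⟩

lemma lintegral_fibre (ht : 0 < t) (hl : 0 < 1 - l * t) (z : ℝ) :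
    ∫⁻ v in unitIrrational, {v | medThetaNE l (t, v) ≤ z}.indicator
      (fun v => ENNReal.ofReal (1 / (1 + t * v) ^ 2)) v = ENNReal.ofReal (medFibre l z t) := by
  obtain ⟨w, hw, hwe, hiff⟩ := exists_fibre_endpoint ht hl z
  rw [setLIntegral_congr unitIrrational_ae_eq, ← hwe, ← integral_one_div_one_add_mul_sq ht hw.1,
    intervalIntegral.integral_of_le hw.1, ofReal_integral_eq_lintegral_ofReal]
  · have e : ∀ v ∈ Set.Ioo (0 : ℝ) 1, {v | medThetaNE l (t, v) ≤ z}.indicator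
        (fun v => ENNReal.ofReal (1 / (1 + t * v) ^ 2)) v =
        (Set.Iic w).indicator (fun v => ENNReal.ofReal (1 / (1 + t * v) ^ 2)) v := by
      intro v hv
      by_cases h : v ≤ w
      · rw [Set.indicator_of_mem (by exact (hiff v hv).2 h), Set.indicator_of_mem (by exact h)]
      · rw [Set.indicator_of_notMem (by exact fun h' => h ((hiff v hv).1 h')),
          Set.indicator_of_notMem (by exact h)]
    rw [setLIntegral_congr_fun measurableSet_Ioo e, setLIntegral_congr Ioo_ae_eq_Ioc,
      setLIntegral_indicator measurableSet_Iic]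
    congr 2
    ext v
    simp only [Set.mem_inter_iff, Set.mem_Iic, Set.mem_Ioc]
    exact ⟨fun h => ⟨h.2.1, h.1⟩, fun h => ⟨h.2, h.1, h.2.trans hw.2⟩⟩
  · refine (ContinuousOn.integrableOn_Icc ?_).mono_set Set.Ioc_subset_Icc_self
    refine continuousOn_const.div (by fun_prop) fun v hv => ?_
    have := hv.1
    positivity
  · filter_upwards with v
    positivity

end Fibres

section Sublevels

variable {a l : ℕ}

lemma measurable_medThetaNE (l : ℝ) : Measurable (medThetaNE l) := by
  unfold medThetaNE; fun_prop

lemma measurableSet_medSublevel (a l : ℕ) (z : ℝ) : MeasurableSet (medSublevel a l z) :=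
  ((measurableSet_digitSet _).prod measurableSet_unitIrrational).inter
    (measurableSet_le (measurable_medThetaNE l) measurable_const)

lemma mem_digitSet_iff {t : ℝ} (ha : 1 ≤ a) :
    t ∈ digitSet a ↔ t ∈ unitIrrational ∧ t ∈ Set.Ioc (1 / ((a : ℝ) + 1)) (1 / a) := by
  have ha' : (0 : ℝ) < a := by exact_mod_cast ha
  refine and_congr_right fun h => ?_
  rw [Int.floor_eq_iff, Set.mem_Ioc, one_div_lt (by positivity) h.1.1, le_one_div h.1.1 ha']
  push_cast
  exact and_comm

lemma digitSet_ae_eq (ha : 1 ≤ a) :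
    digitSet a =ᵐ[volume] Set.Ioc (1 / ((a : ℝ) + 1)) (1 / (a : ℝ)) := by
  have ha' : (1 : ℝ) ≤ a := by exact_mod_cast ha
  have h1 : ∀ᵐ x : ℝ, x ≠ 1 := by
    exact compl_mem_ae_iff.2 (measure_singleton 1)
  filter_upwards [ae_mem_unitIrrational, h1] with x hx hx1
  refine propext ((mem_digitSet_iff ha).trans ⟨fun h => h.2, fun h => ⟨hx ⟨?_, ?_⟩, h⟩⟩)
  · exact lt_trans (by positivity) h.1
  · refine lt_of_le_of_ne (h.2.trans ?_) hx1
    rw [div_le_one (by linarith)]; exact ha'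

lemma one_div_le_one_sub_mul {t : ℝ} (ha : 1 ≤ a) (hl : l ≤ a - 1)
    (ht : t ≤ 1 / a) : 1 / (a : ℝ) ≤ 1 - l * t := by
  have ha' : (0 : ℝ) < a := by exact_mod_cast ha
  have hl' : (l : ℝ) + 1 ≤ a := by exact_mod_cast (by lia : l + 1 ≤ a)
  have h1 : t * a ≤ 1 := (le_div_iff₀ ha').1 ht
  rw [div_le_iff₀ ha']
  nlinarith

lemma continuousOn_medFibre (ha : 1 ≤ a) (hl : l ≤ a - 1) (z : ℝ) :
    ContinuousOn (medFibre l z) (Set.Icc (1 / ((a : ℝ) + 1)) (1 / a)) := by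
  have ha' : (0 : ℝ) < a := by exact_mod_cast ha
  have hpos : ∀ t ∈ Set.Icc (1 / ((a : ℝ) + 1)) (1 / a), 0 < t := fun t ht =>
    lt_of_lt_of_le (by positivity) ht.1
  unfold medFibre
  refine ContinuousOn.sup continuousOn_const (ContinuousOn.inf
    (ContinuousOn.div (by fun_prop) (by fun_prop) ?_) (continuousOn_const.div (by fun_prop) ?_))
  · intro t ht
    have := one_div_le_one_sub_mul ha hl ht.2
    have h1 : 0 < 1 - l * t := lt_of_lt_of_le (by positivity) this
    positivity
  · intro t ht
    have := hpos t ht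
    positivity

lemma one_div_succ_le_one_div (ha : 1 ≤ a) : 1 / ((a : ℝ) + 1) ≤ 1 / a :=
  one_div_le_one_div_of_le (by exact_mod_cast ha) (by linarith)

lemma gaussNEMeasure_real_medSublevel (ha : 1 ≤ a) (hl : l ≤ a - 1) (z : ℝ) :
    gaussNEMeasure.real (medSublevel a l z) =
      ∫ t in (1 / ((a : ℝ) + 1))..(1 / a), medFibre l z t := by
  have ha' : (0 : ℝ) < a := by exact_mod_cast ha
  have hJ := measurableSet_unitIrrational
  have hm := (measurable_gaussDensity).indicator (measurableSet_medSublevel a l z)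
  have h1 : gaussNEMeasure (medSublevel a l z) =
      ∫⁻ t in digitSet a, ENNReal.ofReal (medFibre l z t) := by
    rw [gaussNEMeasure_apply (measurableSet_medSublevel a l z), Measure.volume_eq_prod,
      ← Measure.prod_restrict, lintegral_prod _ hm.aemeasurable]
    have e : ∀ t ∈ unitIrrational, ∫⁻ v in unitIrrational, (medSublevel a l z).indicator
        (fun p => ENNReal.ofReal (1 / (1 + p.1 * p.2) ^ 2)) (t, v) =
        (digitSet a).indicator (fun t => ENNReal.ofReal (medFibre l z t)) t := by
      intro t ht
      by_cases hta : t ∈ digitSet a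
      · have h2 := ((mem_digitSet_iff ha).1 hta).2
        have h3 := one_div_le_one_sub_mul ha hl h2.2
        rw [Set.indicator_of_mem hta, ← lintegral_fibre ht.1.1 (lt_of_lt_of_le (by positivity) h3)]
        refine setLIntegral_congr_fun hJ fun v hv => ?_
        by_cases h : medThetaNE l (t, v) ≤ z
        · rw [Set.indicator_of_mem (show (t, v) ∈ medSublevel a l z from ⟨⟨hta, hv⟩, h⟩),
            Set.indicator_of_mem (by exact h)]
        · rw [Set.indicator_of_notMem (fun h' : (t, v) ∈ medSublevel a l z => h h'.2),
            Set.indicator_of_notMem (by exact h)]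
      · rw [Set.indicator_of_notMem hta]
        refine (setLIntegral_congr_fun hJ fun v hv => ?_).trans lintegral_zero
        exact Set.indicator_of_notMem (fun h' : (t, v) ∈ medSublevel a l z => hta h'.1.1) _
    rw [setLIntegral_congr_fun hJ e, setLIntegral_indicator (measurableSet_digitSet _)]
    congr 2
    exact Set.inter_eq_self_of_subset_left fun t ht => ht.1
  have hnn : ∀ t, 0 ≤ medFibre l z t := fun t => le_max_left _ _
  rw [measureReal_def, h1, setLIntegral_congr (digitSet_ae_eq ha),
    intervalIntegral.integral_of_le (one_div_succ_le_one_div ha),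
    ← ofReal_integral_eq_lintegral_ofReal, ENNReal.toReal_ofReal]
  · exact integral_nonneg hnn
  · exact (continuousOn_medFibre ha hl z).integrableOn_Icc.mono_set Set.Ioc_subset_Icc_self
  · exact .of_forall hnn

lemma continuous_gaussNEMeasure_real_medSublevel (ha : 1 ≤ a) (hl : l ≤ a - 1) :
    Continuous fun z => gaussNEMeasure.real (medSublevel a l z) := by
  have ha' : (0 : ℝ) < a := by exact_mod_cast ha
  simp_rw [gaussNEMeasure_real_medSublevel ha hl]
  refine intervalIntegral.continuous_of_dominated_interval (bound := fun _ => 1) ?_ ?_ ?_ ?_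
  · intro z
    refine ((continuousOn_medFibre ha hl z).mono ?_).aestronglyMeasurable measurableSet_uIoc
    rw [Set.uIoc_of_le (one_div_succ_le_one_div ha)]
    exact Set.Ioc_subset_Icc_self
  · refine fun z => .of_forall fun t ht => ?_
    rw [Set.uIoc_of_le (one_div_succ_le_one_div ha)] at ht
    have h0 : 0 < t := lt_trans (by positivity) ht.1
    rw [Real.norm_eq_abs, medFibre, abs_of_nonneg (le_max_left _ _)]
    refine max_le zero_le_one ((min_le_right _ _).trans ?_)
    rw [div_le_one (by positivity)]; linarith
  · exact intervalIntegrable_const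
  · refine .of_forall fun t _ => ?_
    unfold medFibre; fun_prop

end Sublevels

/-- A function of `medThetaNE l` over the cylinder `digitSet a`, equal to `1` where
`medThetaNE l ≤ z`, to `0` where `w ≤ medThetaNE l`, and affine in between. -/
noncomputable def medRamp (a l : ℕ) (z w : ℝ) (p : ℝ × ℝ) : ℝ :=
  if ⌊1 / p.1⌋ = (a : ℤ) then max 0 (min 1 ((w - medThetaNE l p) / (w - z))) else 0

section Ramp

variable {a l : ℕ} {z w : ℝ}

lemma measurable_medRamp (a l : ℕ) (z w : ℝ) : Measurable (medRamp a l z w) := by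
  refine Measurable.ite ?_ ?_ measurable_const
  · exact (measurable_floor_one_div.comp measurable_fst) (measurableSet_singleton (a : ℤ))
  · exact measurable_const.max (measurable_const.min
      ((measurable_const.sub (measurable_medThetaNE l)).div_const _))

lemma medRamp_nonneg (p : ℝ × ℝ) : 0 ≤ medRamp a l z w p := by
  unfold medRamp
  split_ifs
  exacts [le_max_left _ _, le_rfl]

lemma medRamp_le_one (p : ℝ × ℝ) : medRamp a l z w p ≤ 1 := by
  unfold medRamp
  split_ifs
  exacts [max_le zero_le_one (min_le_left _ _), zero_le_one]

lemma medRamp_eq_one (hzw : z < w) {p : ℝ × ℝ} (hp : ⌊1 / p.1⌋ = (a : ℤ))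
    (hz : medThetaNE l p ≤ z) : medRamp a l z w p = 1 := by
  have h : 1 ≤ (w - medThetaNE l p) / (w - z) := by
    rw [le_div_iff₀ (by linarith)]; linarith
  rw [medRamp, if_pos hp, min_eq_left h, max_eq_right zero_le_one]

lemma medRamp_eq_zero (hzw : z < w) {p : ℝ × ℝ}
    (hp : ¬ (⌊1 / p.1⌋ = (a : ℤ) ∧ medThetaNE l p ≤ w)) : medRamp a l z w p = 0 := by
  unfold medRamp
  split_ifs with h
  · have h1 : w < medThetaNE l p := not_le.1 fun h' => hp ⟨h, h'⟩
    exact max_eq_left ((min_le_right _ _).trans (div_nonpos_of_nonpos_of_nonneg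
      (by linarith) (by linarith)))
  · rfl

lemma abs_medThetaNE_sub_le {l t v v' : ℝ} (ht : 0 < t) (h0 : 0 ≤ 1 - l * t) (hl : 0 ≤ l)
    (hv : 0 ≤ v) (hv' : 0 ≤ v') : |medThetaNE l (t, v) - medThetaNE l (t, v')| ≤ |v - v'| := by
  have h1 : 1 ≤ 1 + t * v := by have := mul_nonneg ht.le hv; linarith
  have h2 : 1 ≤ 1 + t * v' := by have := mul_nonneg ht.le hv'; linarith
  have h3 : 1 - l * t ≤ 1 := by have := mul_nonneg hl ht.le; linarith
  have e : medThetaNE l (t, v) - medThetaNE l (t, v') =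
      (v - v') * ((1 - l * t) ^ 2 / ((1 + t * v) * (1 + t * v'))) := by
    have : 1 + t * v ≠ 0 := by linarith
    have : 1 + t * v' ≠ 0 := by linarith
    simp only [medThetaNE]; field_simp; ring
  have h4 : 1 ≤ (1 + t * v) * (1 + t * v') := one_le_mul_of_one_le_of_one_le h1 h2
  rw [e, abs_mul]
  refine mul_le_of_le_one_right (abs_nonneg _) ?_
  rw [abs_of_nonneg (by positivity), div_le_one (by linarith)]
  exact (pow_le_one₀ h0 h3).trans h4

lemma abs_medRamp_sub_le (hl : l ≤ a) (hzw : z < w) {t : ℝ} (ht : t ∈ unitIrrational)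
    {v v' : ℝ} (hv : 0 ≤ v) (hv' : 0 ≤ v') :
    |medRamp a l z w (t, v) - medRamp a l z w (t, v')| ≤ 1 / (w - z) * |v - v'| := by
  have hwz : 0 < w - z := by linarith
  unfold medRamp
  split_ifs with h
  · have hta : (a : ℝ) ≤ 1 / t := by
      have := Int.floor_le (1 / t)
      rw [show ⌊1 / t⌋ = (a : ℤ) from h] at this
      exact_mod_cast this
    have h0 : 0 ≤ 1 - l * t := by
      have h1 : (l : ℝ) ≤ a := by exact_mod_cast hl
      have h2 := (le_div_iff₀ ht.1.1).1 (h1.trans hta)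
      linarith
    have h3 := abs_medThetaNE_sub_le ht.1.1 h0 (Nat.cast_nonneg l) hv hv'
    calc _ ≤ |min 1 ((w - medThetaNE l (t, v)) / (w - z)) -
          min 1 ((w - medThetaNE l (t, v')) / (w - z))| := by
          rw [max_comm, max_comm 0]
          exact abs_max_sub_max_le_abs _ _ _
      _ ≤ |(w - medThetaNE l (t, v)) / (w - z) - (w - medThetaNE l (t, v')) / (w - z)| := by
          refine (abs_min_sub_min_le_max _ _ _ _).trans ?_
          simp
      _ = 1 / (w - z) * |medThetaNE l (t, v) - medThetaNE l (t, v')| := by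
          rw [← sub_div, abs_div, abs_of_pos hwz, sub_sub_sub_cancel_left, abs_sub_comm]
          ring
      _ ≤ _ := by gcongr
  · simp only [sub_self, abs_zero]
    positivity

lemma integrable_medRamp (a l : ℕ) (z w : ℝ) : Integrable (medRamp a l z w) gaussNEMeasure :=
  .of_bound (measurable_medRamp a l z w).aestronglyMeasurable 1 (.of_forall fun p => by
    rw [Real.norm_eq_abs, abs_of_nonneg (medRamp_nonneg p)]; exact medRamp_le_one p)

lemma measureReal_medSublevel_le_integral_medRamp (hzw : z < w) :
    gaussNEMeasure.real (medSublevel a l z) ≤ ∫ p, medRamp a l z w p ∂gaussNEMeasure := by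
  rw [← integral_indicator_one (measurableSet_medSublevel a l z)]
  refine integral_mono ((integrable_const 1).indicator (measurableSet_medSublevel a l z))
    (integrable_medRamp a l z w) fun p => Set.indicator_le' (fun p hp => ?_)
      (fun p _ => medRamp_nonneg p) p
  rw [medRamp_eq_one hzw hp.1.1.2 hp.2]
  rfl

lemma integral_medRamp_le_measureReal_medSublevel (hzw : z < w) :
    ∫ p, medRamp a l z w p ∂gaussNEMeasure ≤ gaussNEMeasure.real (medSublevel a l w) := by
  rw [← integral_indicator_one (measurableSet_medSublevel a l w)]
  refine integral_mono_ae (integrable_medRamp a l z w)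
    ((integrable_const 1).indicator (measurableSet_medSublevel a l w)) ?_
  filter_upwards [ae_gaussNEMeasure_mem] with p hp
  by_cases h : ⌊1 / p.1⌋ = (a : ℤ) ∧ medThetaNE l p ≤ w
  · rw [Set.indicator_of_mem (show p ∈ medSublevel a l w from ⟨⟨⟨hp.1, h.1⟩, hp.2⟩, h.2⟩)]
    exact medRamp_le_one p
  · rw [medRamp_eq_zero hzw h]
    exact Set.indicator_nonneg (fun _ _ => zero_le_one) p

end Ramp

section Frequency

variable {a l : ℕ} {x z w : ℝ} {N : ℕ}

/-- The number of `j < N` with `a_{j+1} = a` and `medTheta x l j ≤ z`. -/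
noncomputable def medCount (a l : ℕ) (x z : ℝ) (N : ℕ) : ℕ :=
  ((Finset.range N).filter fun j => pquot x j = (a : ℤ) ∧ medTheta x l j ≤ z).card

lemma medCount_mono (h : z ≤ w) : medCount a l x z N ≤ medCount a l x w N :=
  Finset.card_le_card (Finset.monotone_filter_right _ fun _ _ hj => ⟨hj.1, hj.2.trans h⟩)

lemma medCount_div_eq :
    (medCount a l x z N : ℝ) / N =
      (N : ℝ)⁻¹ • ∑ j ∈ Finset.range N,
        if pquot x j = (a : ℤ) ∧ medTheta x l j ≤ z then 1 else 0 := by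
  rw [medCount, Finset.sum_boole, smul_eq_mul, div_eq_inv_mul]

lemma floor_one_div_iterate_gaussNE (x : ℝ) (j : ℕ) :
    ⌊1 / (gaussNE^[j] (x, 0)).1⌋ = pquot x j := by
  rw [iterate_gaussNE_fst, pquot]

lemma medCount_div_le_birkhoffAverage (hx : x ∈ unitIrrational) (hl : l ≤ a) (hzw : z < w) :
    (medCount a l x z N : ℝ) / N ≤ birkhoffAverage ℝ gaussNE (medRamp a l z w) N (x, 0) := by
  rw [medCount_div_eq, birkhoffAverage, birkhoffSum]
  refine smul_le_smul_of_nonneg_left (Finset.sum_le_sum fun j _ => ?_) (by positivity)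
  split_ifs with h
  · rw [medTheta_eq hx (h.1 ▸ by exact_mod_cast hl)] at h
    rw [medRamp_eq_one hzw ((floor_one_div_iterate_gaussNE x j).trans h.1) h.2]
  · exact medRamp_nonneg _

lemma birkhoffAverage_le_medCount_div (hx : x ∈ unitIrrational) (hl : l ≤ a) (hzw : z < w) :
    birkhoffAverage ℝ gaussNE (medRamp a l z w) N (x, 0) ≤ (medCount a l x w N : ℝ) / N := by
  rw [medCount_div_eq, birkhoffAverage, birkhoffSum]
  refine smul_le_smul_of_nonneg_left (Finset.sum_le_sum fun j _ => ?_) (by positivity)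
  split_ifs with h
  · exact medRamp_le_one _
  · refine (medRamp_eq_zero hzw fun h' => h ?_).le
    rw [floor_one_div_iterate_gaussNE] at h'
    rw [medTheta_eq hx (h'.1 ▸ by exact_mod_cast hl)]
    exact h'

theorem ae_tendsto_medCount_div (ha : 1 ≤ a) (hl : l ≤ a - 1) :
    ∀ᵐ x : ℝ, x ∈ unitIrrational → ∀ z, Tendsto (fun N => (medCount a l x z N : ℝ) / N) atTop
      (𝓝 (gaussNEMeasure.real (medSublevel a l z) / gaussNEMeasure.real Set.univ)) := by
  have hla : l ≤ a := by lia
  have hm := gaussNEMeasure_univ_pos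
  have hae : ∀ᵐ x : ℝ, ∀ r s : ℚ, r < s → x ∈ unitIrrational → Tendsto
      (fun N => birkhoffAverage ℝ gaussNE (medRamp a l r s) N (x, 0)) atTop
      (𝓝 ((∫ p, medRamp a l r s p ∂gaussNEMeasure) / gaussNEMeasure.real Set.univ)) := by
    refine ae_all_iff.2 fun r => ae_all_iff.2 fun s => ?_
    by_cases hrs : r < s
    · have hrs' : (r : ℝ) < s := by exact_mod_cast hrs
      have := ae_tendsto_birkhoffAverage_gaussNE (measurable_medRamp a l r s) (C := 1)
        (fun p => by rw [abs_of_nonneg (medRamp_nonneg p)]; exact medRamp_le_one p)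
        (fun t ht v hv v' hv' => abs_medRamp_sub_le hla hrs' ht hv.1 hv'.1)
      filter_upwards [this] with x hx _ using hx
    · exact .of_forall fun x h => absurd h hrs
  have hcont : Continuous fun z =>
      gaussNEMeasure.real (medSublevel a l z) / gaussNEMeasure.real Set.univ :=
    (continuous_gaussNEMeasure_real_medSublevel ha hl).div_const _
  filter_upwards [hae] with x hx hxJ z
  refine tendsto_order.2 ⟨fun c hc => ?_, fun c hc => ?_⟩
  · have hev := hcont.continuousAt.eventually (lt_mem_nhds hc)
    obtain ⟨u, hu, hu'⟩ := exists_Ioc_subset_of_mem_nhds hev ⟨z - 1, by linarith⟩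
    obtain ⟨r, hr1, hr2⟩ := exists_rat_btwn hu
    obtain ⟨s, hs1, hs2⟩ := exists_rat_btwn hr2
    have hVr : c < _ := hu' ⟨hr1, hr2.le⟩
    have hlim := hx r s (by exact_mod_cast hs1) hxJ
    have hlt := hVr.trans_le (div_le_div_of_nonneg_right
      (measureReal_medSublevel_le_integral_medRamp (a := a) (l := l) hs1) hm.le)
    filter_upwards [hlim.eventually (lt_mem_nhds hlt)] with N hN
    refine hN.trans_le ((birkhoffAverage_le_medCount_div hxJ hla hs1).trans ?_)
    gcongr
    exact medCount_mono hs2.le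
  · have hev := hcont.continuousAt.eventually (gt_mem_nhds hc)
    obtain ⟨u, hu, hu'⟩ := exists_Ico_subset_of_mem_nhds hev ⟨z + 1, by linarith⟩
    obtain ⟨s, hs1, hs2⟩ := exists_rat_btwn hu
    obtain ⟨r, hr1, hr2⟩ := exists_rat_btwn hs1
    have hVs : _ < c := hu' ⟨hs1.le, hs2⟩
    have hlim := hx r s (by exact_mod_cast hr2) hxJ
    have hlt := (div_le_div_of_nonneg_right
      (integral_medRamp_le_measureReal_medSublevel (a := a) (l := l) hr2) hm.le).trans_lt hVs
    filter_upwards [hlim.eventually (gt_mem_nhds hlt)] with N hN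
    refine lt_of_le_of_lt ?_ hN
    refine le_trans ?_ (medCount_div_le_birkhoffAverage hxJ hla hr2)
    gcongr
    exact medCount_mono hr1.le

end Frequency

section FibreIntegral

variable {l z t : ℝ}

lemma medFibre_eq_zero (h : z ≤ l * (1 - l * t)) : medFibre l z t = 0 :=
  max_eq_left ((min_le_left _ _).trans
    (div_nonpos_of_nonpos_of_nonneg (by linarith) (sq_nonneg _)))

lemma medFibre_eq_one_div (ht : 0 ≤ t) (hl : 0 < 1 - l * t)
    (h : (l + 1) * (1 - l * t) ≤ z * (1 + t)) : medFibre l z t = 1 / (1 + t) := by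
  rw [medFibre, min_eq_right, max_eq_right (by positivity)]
  rw [div_le_div_iff₀ (by positivity) (by positivity)]
  linear_combination h

lemma medFibre_eq_div (ht : 0 ≤ t) (hl : 0 < 1 - l * t) (h0 : l * (1 - l * t) ≤ z)
    (h : z * (1 + t) ≤ (l + 1) * (1 - l * t)) :
    medFibre l z t = (z - l * (1 - l * t)) / (1 - l * t) ^ 2 := by
  rw [medFibre, min_eq_left, max_eq_right]
  · exact div_nonneg (by linarith) (sq_nonneg _)
  · rw [div_le_div_iff₀ (by positivity) (by positivity)]
    linear_combination h

lemma integral_one_div_one_add {s t : ℝ} (hs : 0 ≤ s) (hst : s ≤ t) :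
    ∫ r in s..t, 1 / (1 + r) = Real.log (1 + t) - Real.log (1 + s) := by
  have hpos : ∀ r ∈ Set.uIcc s t, 1 + r ≠ 0 := by
    intro r hr
    rw [Set.uIcc_of_le hst] at hr
    linarith [hr.1]
  rw [intervalIntegral.integral_eq_sub_of_hasDerivAt (f := fun r => Real.log (1 + r))]
  · exact fun r hr => ((hasDerivAt_id r).const_add 1).log (hpos r hr)
  · exact (continuousOn_const.div (by fun_prop) hpos).intervalIntegrable

lemma integral_sub_div_one_sub_mul_sq {s t : ℝ} (hst : s ≤ t) (h0 : 0 ≤ l)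
    (hl : 0 < 1 - l * t) :
    ∫ r in s..t, (z - l * (1 - l * r)) / (1 - l * r) ^ 2 =
      z * t / (1 - l * t) + Real.log (1 - l * t) -
        (z * s / (1 - l * s) + Real.log (1 - l * s)) := by
  have hpos : ∀ r ∈ Set.uIcc s t, 0 < 1 - l * r := by
    intro r hr
    rw [Set.uIcc_of_le hst] at hr
    have := mul_le_mul_of_nonneg_left hr.2 h0
    linarith
  rw [intervalIntegral.integral_eq_sub_of_hasDerivAt
    (f := fun r => z * r / (1 - l * r) + Real.log (1 - l * r))]
  · intro r hr
    have h1 := hpos r hr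
    have h2 := ((hasDerivAt_id r).const_mul l).const_sub 1
    refine ((((hasDerivAt_id r).const_mul z).div h2 h1.ne').add (h2.log h1.ne')).congr_deriv ?_
    simp only [id]
    field_simp
    ring
  · refine ContinuousOn.intervalIntegrable (ContinuousOn.div (by fun_prop) (by fun_prop) ?_)
    exact fun r hr => (pow_pos (hpos r hr) 2).ne'

/-- The measure of a sublevel set when the fibres are empty to the left of `t₀`, full to the right
of `t₁`, and proper in between. -/
lemma integral_medFibre {L R t₀ t₁ : ℝ} (hL : 0 < L) (h0 : 0 ≤ l) (hz : 0 ≤ z)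
    (hR : 0 < 1 - l * R) (hL0 : L ≤ t₀) (h01 : t₀ ≤ t₁) (h1R : t₁ ≤ R)
    (hc : ContinuousOn (medFibre l z) (Set.Icc L R))
    (hempty : t₀ = L ∨ z ≤ l * (1 - l * t₀)) (hlow : l * (1 - l * t₀) ≤ z)
    (hupp : z * (1 + t₁) ≤ (l + 1) * (1 - l * t₁))
    (hfull : t₁ = R ∨ (l + 1) * (1 - l * t₁) ≤ z * (1 + t₁)) :
    ∫ t in L..R, medFibre l z t =
      z * t₁ / (1 - l * t₁) + Real.log (1 - l * t₁) - Real.log (1 + t₁) -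
        (z * t₀ / (1 - l * t₀) + Real.log (1 - l * t₀)) + Real.log (1 + R) := by
  have hpos : ∀ {t}, t ≤ R → 0 < 1 - l * t := fun {t} ht => by
    have := mul_le_mul_of_nonneg_left ht h0
    linarith
  have hint : ∀ {s t : ℝ}, L ≤ s → s ≤ t → t ≤ R →
      IntervalIntegrable (medFibre l z) volume s t := fun {s t} hs hst ht =>
    (hc.mono (by rw [Set.uIcc_of_le hst]; exact Set.Icc_subset_Icc hs ht)).intervalIntegrable
  have e1 : ∫ t in L..t₀, medFibre l z t = 0 := by
    rcases hempty with rfl | h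
    · exact intervalIntegral.integral_same
    · refine (intervalIntegral.integral_congr fun t ht => ?_).trans
        intervalIntegral.integral_zero
      rw [Set.uIcc_of_le hL0] at ht
      have := mul_le_mul_of_nonneg_left ht.2 h0
      exact medFibre_eq_zero (h.trans (by gcongr))
  have e2 : ∫ t in t₀..t₁, medFibre l z t = z * t₁ / (1 - l * t₁) + Real.log (1 - l * t₁) -
      (z * t₀ / (1 - l * t₀) + Real.log (1 - l * t₀)) := by
    rw [← integral_sub_div_one_sub_mul_sq h01 h0 (hpos h1R)]
    refine intervalIntegral.integral_congr fun t ht => ?_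
    rw [Set.uIcc_of_le h01] at ht
    have h2 : l * t₀ ≤ l * t := by gcongr; exact ht.1
    have h3 : l * t ≤ l * t₁ := by gcongr; exact ht.2
    have ht0 : 0 ≤ t := (hL.le.trans hL0).trans ht.1
    refine medFibre_eq_div ht0 (hpos (ht.2.trans h1R)) (le_trans ?_ hlow) ?_
    · gcongr
    · calc z * (1 + t) ≤ z * (1 + t₁) := by gcongr; exact ht.2
        _ ≤ _ := hupp
        _ ≤ _ := by gcongr
  have e3 : ∫ t in t₁..R, medFibre l z t = Real.log (1 + R) - Real.log (1 + t₁) := by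
    rcases hfull with rfl | h
    · rw [intervalIntegral.integral_same, sub_self]
    · rw [← integral_one_div_one_add ((hL.le.trans hL0).trans h01) h1R]
      refine intervalIntegral.integral_congr fun t ht => ?_
      rw [Set.uIcc_of_le h1R] at ht
      have h3 : l * t₁ ≤ l * t := by gcongr; exact ht.1
      have ht0 : 0 ≤ t := ((hL.le.trans hL0).trans h01).trans ht.1
      refine medFibre_eq_one_div ht0 (hpos ht.2) ?_
      calc _ ≤ (l + 1) * (1 - l * t₁) := by gcongr
        _ ≤ _ := h
        _ ≤ _ := by gcongr; exact ht.1
  rw [← intervalIntegral.integral_add_adjacent_intervals (hint le_rfl hL0 (h01.trans h1R))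
    (hint hL0 (h01.trans h1R) le_rfl), ← intervalIntegral.integral_add_adjacent_intervals
    (hint hL0 h01 h1R) (hint (hL0.trans h01) h1R le_rfl), e1, e2, e3]
  ring

end FibreIntegral

section Endpoints

variable {l z : ℝ}

lemma one_sub_mul_lower (hl : 0 < l) : 1 - l * ((l - z) / l ^ 2) = z / l := by
  field_simp; ring

lemma one_sub_mul_upper (hl : 0 ≤ l) (hz : 0 < z) :
    1 - l * ((l + 1 - z) / (z + l * (l + 1))) = z * (l + 1) / (z + l * (l + 1)) := by
  have : 0 < z + l * (l + 1) := by positivity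
  field_simp; ring

lemma one_add_upper (hl : 0 ≤ l) (hz : 0 < z) :
    1 + (l + 1 - z) / (z + l * (l + 1)) = (l + 1) ^ 2 / (z + l * (l + 1)) := by
  have : 0 < z + l * (l + 1) := by positivity
  field_simp; ring

lemma lower_primitive (hl : 0 < l) (hz : 0 < z) :
    z * ((l - z) / l ^ 2) / (1 - l * ((l - z) / l ^ 2)) +
      Real.log (1 - l * ((l - z) / l ^ 2)) = 1 - z / l + (Real.log z - Real.log l) := by
  rw [one_sub_mul_lower hl, Real.log_div hz.ne' hl.ne']
  field_simp

lemma upper_primitive (hl : 0 ≤ l) (hz : 0 < z) :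
    z * ((l + 1 - z) / (z + l * (l + 1))) / (1 - l * ((l + 1 - z) / (z + l * (l + 1)))) +
      Real.log (1 - l * ((l + 1 - z) / (z + l * (l + 1)))) -
      Real.log (1 + (l + 1 - z) / (z + l * (l + 1))) =
    1 - z / (l + 1) + (Real.log z - Real.log (l + 1)) := by
  have h : 0 < z + l * (l + 1) := by positivity
  have hl1 : 0 < l + 1 := by linarith
  rw [one_sub_mul_upper hl hz, one_add_upper hl hz, Real.log_div (by positivity) h.ne',
    Real.log_div (by positivity) h.ne', Real.log_mul hz.ne' hl1.ne', Real.log_pow]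
  field_simp
  push_cast
  ring

end Endpoints

section Distribution

variable {a l : ℕ} {z : ℝ}

lemma cast_bounds (ha : 1 ≤ a) (hl : l ≤ a - 1) : (1 : ℝ) ≤ a ∧ (l : ℝ) + 1 ≤ a :=
  ⟨by exact_mod_cast ha, by exact_mod_cast (by lia : l + 1 ≤ a)⟩

lemma left_primitive (ha : 1 ≤ a) (hl : l ≤ a - 1) :
    z * (1 / ((a : ℝ) + 1)) / (1 - l * (1 / ((a : ℝ) + 1))) +
      Real.log (1 - l * (1 / ((a : ℝ) + 1))) =
    z / (a - l + 1) + (Real.log (a - l + 1) - Real.log (a + 1)) := by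
  obtain ⟨ha', hl'⟩ := cast_bounds ha hl
  have h1 : 0 < (a : ℝ) + 1 := by linarith
  have h2 : 0 < (a : ℝ) - l + 1 := by linarith
  have e : 1 - l * (1 / ((a : ℝ) + 1)) = (a - l + 1) / (a + 1) := by field_simp; ring
  rw [e, Real.log_div h2.ne' h1.ne']
  field_simp

lemma right_primitive (ha : 1 ≤ a) (hl : l ≤ a - 1) :
    z * (1 / (a : ℝ)) / (1 - l * (1 / (a : ℝ))) + Real.log (1 - l * (1 / (a : ℝ))) =
    z / (a - l) + (Real.log (a - l) - Real.log a) := by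
  obtain ⟨ha', hl'⟩ := cast_bounds ha hl
  have h1 : 0 < (a : ℝ) := by linarith
  have h2 : 0 < (a : ℝ) - l := by linarith
  have e : 1 - l * (1 / (a : ℝ)) = (a - l) / a := by field_simp
  rw [e, Real.log_div h2.ne' h1.ne']
  field_simp

lemma log_one_add_one_div (ha : 1 ≤ a) :
    Real.log (1 + 1 / (a : ℝ)) = Real.log (a + 1) - Real.log a := by
  have h1 : (0 : ℝ) < a := by exact_mod_cast ha
  rw [← Real.log_div (by positivity) h1.ne', add_div, div_self h1.ne']

lemma one_sub_mul_one_div_pos (ha : 1 ≤ a) (hl : l ≤ a - 1) : 0 < 1 - (l : ℝ) * (1 / a) := by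
  have h : (0 : ℝ) < 1 / a := by positivity
  exact h.trans_le (one_div_le_one_sub_mul ha hl le_rfl)

lemma gaussNEMeasure_real_medSublevel_add_one (ha : 1 ≤ a) (hl : l ≤ a - 1) :
    gaussNEMeasure.real (medSublevel a l (l + 1)) = C11 a := by
  obtain ⟨ha', hl'⟩ := cast_bounds ha hl
  have hL : 0 < 1 / ((a : ℝ) + 1) := by positivity
  have hLR := one_div_succ_le_one_div ha
  have e : ∫ t in (1 / ((a : ℝ) + 1))..(1 / a), medFibre l (l + 1) t =
      ∫ t in (1 / ((a : ℝ) + 1))..(1 / a), 1 / (1 + t) := by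
    refine intervalIntegral.integral_congr fun t ht => ?_
    rw [Set.uIcc_of_le hLR] at ht
    have ht0 : 0 ≤ t := hL.le.trans ht.1
    have h0 : (0 : ℝ) ≤ l * t := by positivity
    have h1 : (0 : ℝ) < 1 / a := by positivity
    refine medFibre_eq_one_div ht0 (h1.trans_le (one_div_le_one_sub_mul ha hl ht.2)) ?_
    gcongr
    linarith
  have e1 : Real.log (1 + 1 / ((a : ℝ) + 1)) = Real.log (a + 2) - Real.log (a + 1) := by
    rw [← Real.log_div (by positivity) (by positivity)]
    congr 1
    field_simp
    ring
  rw [gaussNEMeasure_real_medSublevel ha hl, e, integral_one_div_one_add hL.le hLR,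
    log_one_add_one_div ha, e1, C11, Real.log_div (by positivity) (by positivity),
    Real.log_mul (by positivity) (by positivity), Real.log_pow]
  push_cast
  ring

lemma C11_pos (ha : 1 ≤ a) : 0 < C11 a := by
  have h1 : (0 : ℝ) < a := by exact_mod_cast ha
  refine Real.log_pos ?_
  rw [lt_div_iff₀ (by positivity)]
  linarith

lemma gaussNEMeasure_real_medSublevel_of_le_min (ha : 1 ≤ a) (hl : l ≤ a - 1) (hl1 : 1 ≤ l)
    (h1 : ((a : ℝ) - l) * l / a ≤ z)
    (h2 : z ≤ min (((a : ℝ) - l + 1) * l) ((a - l) * (l + 1)) / (a + 1)) :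
    gaussNEMeasure.real (medSublevel a l z) =
      a * z / ((a - l) * l) - 1 + Real.log ((a - l) * l / (a * z)) := by
  obtain ⟨ha', hl'⟩ := cast_bounds ha hl
  have hl0 : (0 : ℝ) < l := by exact_mod_cast hl1
  have hal : 0 < (a : ℝ) - l := by linarith
  have ha0 : (0 : ℝ) < a := by linarith
  have hz : 0 < z := lt_of_lt_of_le (by positivity) h1
  rw [div_le_iff₀ (by positivity)] at h1
  rw [le_div_iff₀ (by positivity), le_min_iff] at h2
  rw [gaussNEMeasure_real_medSublevel ha hl,
    integral_medFibre (t₀ := (l - z) / l ^ 2) (t₁ := 1 / a) (by positivity) hl0.le hz.le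
      (one_sub_mul_one_div_pos ha hl) ?_ ?_ le_rfl (continuousOn_medFibre ha hl z) (.inr ?_) ?_ ?_
      (.inl rfl), lower_primitive hl0 hz, right_primitive ha hl,
      Real.log_div (by positivity) (by positivity), Real.log_mul (by positivity) (by positivity),
      Real.log_mul (by positivity) (by positivity)]
  · field_simp
    ring
  · rw [div_le_div_iff₀ (by positivity) (by positivity)]
    linarith
  · rw [div_le_div_iff₀ (by positivity) (by positivity)]
    linarith
  · rw [one_sub_mul_lower hl0, mul_div_cancel₀ _ hl0.ne']
  · rw [one_sub_mul_lower hl0, mul_div_cancel₀ _ hl0.ne']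
  · field_simp
    linarith

lemma gaussNEMeasure_real_medSublevel_of_mem_Icc (ha : 1 ≤ a) (hl : l ≤ a - 1)
    (h1 : ((a : ℝ) - l) * (l + 1) / (a + 1) ≤ z) (h2 : z ≤ ((a : ℝ) - l + 1) * l / (a + 1)) :
    gaussNEMeasure.real (medSublevel a l z) =
      z / (l * (l + 1)) + Real.log ((a + 1) * l / (a * (l + 1))) := by
  obtain ⟨ha', hl'⟩ := cast_bounds ha hl
  have hal : 0 < (a : ℝ) - l := by linarith
  have ha0 : (0 : ℝ) < a := by linarith
  have hz : 0 < z := lt_of_lt_of_le (by positivity) h1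
  have hl0 : (0 : ℝ) < l := by
    rcases (Nat.cast_nonneg (α := ℝ) l).eq_or_lt with h | h
    · rw [← h, mul_zero, zero_div] at h2; linarith
    · exact h
  rw [div_le_iff₀ (by positivity)] at h1
  rw [le_div_iff₀ (by positivity)] at h2
  rw [gaussNEMeasure_real_medSublevel ha hl,
    integral_medFibre (t₀ := (l - z) / l ^ 2) (t₁ := (l + 1 - z) / (z + l * (l + 1)))
      (by positivity) hl0.le hz.le (one_sub_mul_one_div_pos ha hl) ?_ ?_ ?_
      (continuousOn_medFibre ha hl z) (.inr ?_) ?_ ?_ (.inr ?_), lower_primitive hl0 hz,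
      upper_primitive hl0.le hz, log_one_add_one_div ha,
      Real.log_div (by positivity) (by positivity), Real.log_mul (by positivity) (by positivity),
      Real.log_mul (by positivity) (by positivity)]
  · field_simp
    ring
  · rw [div_le_div_iff₀ (by positivity) (by positivity)]
    linarith
  · rw [div_le_div_iff₀ (by positivity) (by positivity)]
    nlinarith
  · rw [div_le_div_iff₀ (by positivity) (by positivity)]
    linarith
  · rw [one_sub_mul_lower hl0, mul_div_cancel₀ _ hl0.ne']
  · rw [one_sub_mul_lower hl0, mul_div_cancel₀ _ hl0.ne']
  · rw [one_sub_mul_upper hl0.le hz, one_add_upper hl0.le hz]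
    exact (by ring : z * ((l + 1) ^ 2 / (z + l * (l + 1))) =
      (l + 1) * (z * ((l : ℝ) + 1) / (z + l * (l + 1)))).le
  · rw [one_sub_mul_upper hl0.le hz, one_add_upper hl0.le hz]
    exact (by ring : z * ((l + 1) ^ 2 / (z + l * (l + 1))) =
      (l + 1) * (z * ((l : ℝ) + 1) / (z + l * (l + 1)))).ge

lemma gaussNEMeasure_real_medSublevel_of_mem_Icc' (ha : 1 ≤ a) (hl : l ≤ a - 1)
    (h1 : ((a : ℝ) - l + 1) * l / (a + 1) ≤ z) (h2 : z ≤ ((a : ℝ) - l) * (l + 1) / (a + 1)) :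
    gaussNEMeasure.real (medSublevel a l z) =
      z / ((a - l) * (a - l + 1)) + Real.log ((a + 1) * (a - l) / (a * (a - l + 1))) := by
  obtain ⟨ha', hl'⟩ := cast_bounds ha hl
  have hal : 0 < (a : ℝ) - l := by linarith
  have ha0 : (0 : ℝ) < a := by linarith
  have hl0 : (0 : ℝ) ≤ l := Nat.cast_nonneg l
  have hz : 0 ≤ z := le_trans (by positivity) h1
  rw [div_le_iff₀ (by positivity)] at h1
  rw [le_div_iff₀ (by positivity)] at h2
  rw [gaussNEMeasure_real_medSublevel ha hl,
    integral_medFibre (t₀ := 1 / (a + 1)) (t₁ := 1 / a) (by positivity) hl0 hz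
      (one_sub_mul_one_div_pos ha hl) le_rfl (one_div_succ_le_one_div ha) le_rfl
      (continuousOn_medFibre ha hl z) (.inl rfl) ?_ ?_ (.inl rfl), left_primitive ha hl,
      right_primitive ha hl, Real.log_div (by positivity) (by positivity),
      Real.log_mul (by positivity) (by positivity), Real.log_mul (by positivity) (by positivity)]
  · field_simp
    ring
  · field_simp
    linarith
  · field_simp
    linarith

lemma gaussNEMeasure_real_medSublevel_of_max_le (ha : 1 ≤ a) (hl : l ≤ a - 1)
    (h1 : max (((a : ℝ) - l + 1) * l) ((a - l) * (l + 1)) / (a + 1) ≤ z)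
    (h2 : z ≤ ((a : ℝ) - l + 1) * (l + 1) / (a + 2)) :
    gaussNEMeasure.real (medSublevel a l z) =
      1 - (a + 2) * z / ((a - l + 1) * (l + 1)) +
        Real.log ((a + 1) ^ 2 * z / (a * ((a - l + 1) * (l + 1)))) := by
  obtain ⟨ha', hl'⟩ := cast_bounds ha hl
  have hal : 0 < (a : ℝ) - l := by linarith
  have ha0 : (0 : ℝ) < a := by linarith
  have hl0 : (0 : ℝ) ≤ l := Nat.cast_nonneg l
  rw [div_le_iff₀ (by positivity), max_le_iff] at h1
  rw [le_div_iff₀ (by positivity)] at h2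
  have hz : 0 < z := by
    have : 0 < ((a : ℝ) - l) * (l + 1) := by positivity
    exact pos_of_mul_pos_left (this.trans_le h1.2) (by positivity)
  rw [gaussNEMeasure_real_medSublevel ha hl,
    integral_medFibre (t₀ := 1 / (a + 1)) (t₁ := (l + 1 - z) / (z + l * (l + 1)))
      (by positivity) hl0 hz.le (one_sub_mul_one_div_pos ha hl) le_rfl ?_ ?_
      (continuousOn_medFibre ha hl z) (.inl rfl) ?_ ?_ (.inr ?_), left_primitive ha hl,
      upper_primitive hl0 hz, log_one_add_one_div ha,
      Real.log_div (by positivity) (by positivity), Real.log_mul (by positivity) (by positivity),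
      Real.log_mul (by positivity) (by positivity), Real.log_mul (by positivity) (by positivity),
      Real.log_pow]
  · field_simp
    push_cast
    ring
  · rw [div_le_div_iff₀ (by positivity) (by positivity)]
    linarith
  · rw [div_le_div_iff₀ (by positivity) (by positivity)]
    linarith
  · field_simp
    linarith
  · rw [one_sub_mul_upper hl0 hz, one_add_upper hl0 hz]
    exact (by ring : z * ((l + 1) ^ 2 / (z + l * (l + 1))) =
      (l + 1) * (z * ((l : ℝ) + 1) / (z + l * (l + 1)))).le
  · rw [one_sub_mul_upper hl0 hz, one_add_upper hl0 hz]
    exact (by ring : z * ((l + 1) ^ 2 / (z + l * (l + 1))) =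
      (l + 1) * (z * ((l : ℝ) + 1) / (z + l * (l + 1)))).ge

end Distribution

section Bounds

variable {a l : ℕ}

lemma medTheta_eq_div {x : ℝ} (hx : x ∈ unitIrrational) (hl : l ≤ a) {j : ℕ}
    (hj : pquot x j = (a : ℤ)) :
    medTheta x l j = (l + (qden x j : ℝ) / qden x (j + 1)) * (a + gaussMap^[j + 1] x - l) /
      (a + gaussMap^[j + 1] x + (qden x j : ℝ) / qden x (j + 1)) := by
  have hs := (iterate_gaussMap_mem hx (j + 1)).1.1
  have ha : (1 : ℝ) ≤ a := by
    have := one_le_pquot hx j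
    rw [hj] at this
    exact_mod_cast this
  have hv := (iterate_gaussNE_snd_mem hx (v := 0) (by simp) j).1
  rw [medTheta_eq hx (hj ▸ by exact_mod_cast hl), medThetaNE, iterate_gaussNE_fst,
    iterate_gaussMap_eq x j, hj, iterate_gaussNE_zero_snd hx]
  rw [iterate_gaussNE_zero_snd hx] at hv
  push_cast
  generalize (qden x j : ℝ) / qden x (j + 1) = v at hv ⊢
  generalize gaussMap^[j + 1] x = s at hs ⊢
  have h1 : 0 < a + s := by linarith
  have h2 : 0 < a + s + v := by linarith
  field_simp

lemma lt_medTheta_and_lt {x : ℝ} (hx : x ∈ unitIrrational) (hl : l ≤ a - 1) {j : ℕ}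
    (hj : pquot x j = (a : ℤ)) (h0 : ¬(j = 0 ∧ l = 0)) :
    ((a : ℝ) - l) * l / a < medTheta x l j ∧
      medTheta x l j < ((a : ℝ) - l + 1) * (l + 1) / (a + 2) := by
  have hs := (iterate_gaussMap_mem hx (j + 1)).1
  have ha : 1 ≤ a := by
    have := one_le_pquot hx j
    rw [hj] at this
    exact_mod_cast this
  have ha' : (1 : ℝ) ≤ a := by exact_mod_cast ha
  have hl' : (l : ℝ) + 1 ≤ a := by exact_mod_cast (by lia : l + 1 ≤ a)
  have hl0 : (0 : ℝ) ≤ l := Nat.cast_nonneg l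
  have hv := iterate_gaussNE_snd_mem hx (v := 0) (by simp) j
  have hlv : 0 < (l : ℝ) ∨ 0 < (qden x j : ℝ) / qden x (j + 1) := by
    rcases Nat.eq_zero_or_pos l with h | h
    · obtain ⟨i, rfl⟩ := Nat.exists_eq_succ_of_ne_zero fun h' => h0 ⟨h', h⟩
      have h1 : (1 : ℝ) ≤ qden x (i + 1) := by exact_mod_cast (qden_nonneg_and_one_le hx i).2
      have h2 : (1 : ℝ) ≤ qden x (i + 1 + 1) := by
        exact_mod_cast (qden_nonneg_and_one_le hx (i + 1)).2
      exact .inr (by rw [Nat.succ_eq_add_one]; positivity)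
    · exact .inl (by exact_mod_cast h)
  rw [iterate_gaussNE_zero_snd hx] at hv
  rw [medTheta_eq_div hx (by lia) hj]
  generalize (qden x j : ℝ) / qden x (j + 1) = v at hv hlv ⊢
  generalize gaussMap^[j + 1] x = s at hs ⊢
  obtain ⟨hs0, hs1⟩ := hs
  obtain ⟨hv0, hv1⟩ := hv
  have h2 : 0 < a + s + v := by linarith
  have hal : 1 ≤ (a : ℝ) - l := by linarith
  constructor
  · rw [div_lt_div_iff₀ (by positivity) h2]
    have h : 0 < (l : ℝ) ^ 2 * s + (a - l) ^ 2 * v := by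
      rcases hlv with h | h
      · have : 0 < (l : ℝ) ^ 2 * s := by positivity
        positivity
      · have : 0 < ((a : ℝ) - l) ^ 2 * v := by positivity
        positivity
    have h' : 0 ≤ a * v * s := by positivity
    linear_combination h + h'
  · rw [div_lt_div_iff₀ h2 (by positivity)]
    have h3 : 0 < 1 - s := by linarith
    have h4 : 0 ≤ 1 - v := by linarith
    have h5 : (a + 2) * (1 - s) * (1 - v) < (l + 1) ^ 2 * (1 - s) + (a - l + 1) ^ 2 * (1 - v) := by
      have h6 : (1 - s) * (1 - v) ≤ (l + 1) * (1 - s) := by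
        nlinarith [mul_nonneg h3.le hv0, mul_nonneg hl0 h3.le]
      have h7 : (1 - s) * (1 - v) ≤ 1 - v := mul_le_of_le_one_left h4 (by linarith)
      have h9 := mul_le_mul_of_nonneg_left h6 (by positivity : 0 ≤ (l : ℝ) + 1)
      rcases h4.eq_or_lt with h | h
      · rw [← h]
        have : 0 < ((l : ℝ) + 1) ^ 2 * (1 - s) := by positivity
        linarith
      · have h8' : 1 - v < (a - l + 1) * (1 - v) := lt_mul_of_one_lt_left h (by linarith)
        have h10 := mul_lt_mul_of_pos_left (h7.trans_lt h8') (by linarith : 0 < (a : ℝ) - l + 1)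
        linarith
    linear_combination h5

lemma medTheta_le_add_one {x : ℝ} (hx : x ∈ unitIrrational) (hl : l ≤ a) {j : ℕ}
    (hj : pquot x j = (a : ℤ)) : medTheta x l j ≤ l + 1 := by
  have hs := (iterate_gaussMap_mem hx (j + 1)).1.1
  have ha : (1 : ℝ) ≤ a := by
    have := one_le_pquot hx j
    rw [hj] at this
    exact_mod_cast this
  have hl0 : (0 : ℝ) ≤ l := Nat.cast_nonneg l
  have hv := iterate_gaussNE_snd_mem hx (v := 0) (by simp) j
  rw [iterate_gaussNE_zero_snd hx] at hv
  rw [medTheta_eq_div hx hl hj, div_le_iff₀ (by linarith [hv.1])]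
  generalize (qden x j : ℝ) / qden x (j + 1) = v at hv ⊢
  have hla : (l : ℝ) ≤ a := by exact_mod_cast hl
  refine mul_le_mul (by linarith [hv.2]) (by linarith [hv.1]) (by linarith) (by linarith)

end Bounds

section Subsequence

lemma card_filter_nth {p : ℕ → Prop} [DecidablePred p] (hp : {j | p j}.Infinite) (q : ℕ → Prop)
    [DecidablePred q] (n : ℕ) :
    ((Finset.range n).filter fun k => q (Nat.nth p k)).card =
      ((Finset.range (Nat.nth p n)).filter fun j => p j ∧ q j).card := by
  rw [← Finset.card_image_of_injective _ (Nat.nth_injective hp)]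
  congr 1
  ext j
  simp only [Finset.mem_image, Finset.mem_filter, Finset.mem_range]
  constructor
  · rintro ⟨k, ⟨hk, hq⟩, rfl⟩
    exact ⟨Nat.nth_strictMono hp hk, Nat.nth_mem_of_infinite hp k, hq⟩
  · rintro ⟨hj, hpj, hqj⟩
    refine ⟨Nat.count p j, ⟨?_, by rwa [Nat.nth_count hpj]⟩, Nat.nth_count hpj⟩
    rw [← Nat.nth_count hpj] at hj
    exact (Nat.nth_lt_nth hp).1 hj

variable {a l : ℕ} {x : ℝ}

lemma infinite_of_tendsto_medCount {z c : ℝ} (hc : 0 < c)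
    (h : Tendsto (fun N => (medCount a l x z N : ℝ) / N) atTop (𝓝 c)) :
    {j : ℕ | pquot x j = (a : ℤ)}.Infinite := by
  intro hfin
  have hle : ∀ N, (medCount a l x z N : ℝ) ≤ hfin.toFinset.card := fun N => by
    refine Nat.cast_le.2 (Finset.card_le_card fun j hj => ?_)
    exact hfin.mem_toFinset.2 (Finset.mem_filter.1 hj).2.1
  refine hc.ne (tendsto_nhds_unique ?_ h)
  refine squeeze_zero (fun N => by positivity) (fun N => ?_)
    (tendsto_const_div_atTop_nhds_zero_nat (hfin.toFinset.card : ℝ))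
  exact div_le_div_of_nonneg_right (hle N) (Nat.cast_nonneg N)

/-- Passing from frequencies among all indices to frequencies among the indices with
`a_{j+1} = a`. -/
lemma tendsto_card_filter_nth_div (hx : x ∈ unitIrrational) (hl : l ≤ a) {z c d : ℝ} (hc : 0 < c)
    (h : Tendsto (fun N => (medCount a l x (l + 1) N : ℝ) / N) atTop (𝓝 c))
    (hz : Tendsto (fun N => (medCount a l x z N : ℝ) / N) atTop (𝓝 d)) :
    Tendsto (fun n : ℕ => (((Finset.range n).filter fun k =>
      medTheta x l (Nat.nth (fun j => pquot x j = (a : ℤ)) k) ≤ z).card : ℝ) / n)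
      atTop (𝓝 (d / c)) := by
  have hinf := infinite_of_tendsto_medCount hc h
  have hnth := (Nat.nth_strictMono hinf).tendsto_atTop
  have hn : ∀ n, medCount a l x (l + 1) (Nat.nth (fun j => pquot x j = (a : ℤ)) n) = n := by
    intro n
    rw [medCount, ← card_filter_nth hinf fun j => medTheta x l j ≤ l + 1,
      Finset.filter_true_of_mem, Finset.card_range]
    exact fun k _ => medTheta_le_add_one hx hl (Nat.nth_mem_of_infinite hinf k)
  refine ((hz.comp hnth).div (h.comp hnth) hc.ne').congr' ?_
  filter_upwards [eventually_gt_atTop 0] with n hn0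
  have hpos : Nat.nth (fun j => pquot x j = (a : ℤ)) n ≠ 0 := fun h0 => by
    have := (Nat.nth_strictMono hinf).le_apply (x := n)
    lia
  rw [Pi.div_apply, Function.comp_apply, Function.comp_apply, hn, div_div_div_cancel_right₀
    (by exact_mod_cast hpos), card_filter_nth hinf fun j => medTheta x l j ≤ z]
  rfl

end Subsequence

/-- Bounds and limiting distribution for the approximation coefficients of the `λ`-th
mediants `(λ p_j + p_{j−1})/(λ q_j + q_{j−1})` over those `j` with `a_{j+1} = a`. -/
theorem stmt_11 (a lam : ℕ) (ha : 1 ≤ a) (hlam : lam ≤ a - 1) :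
    (∀ x : ℝ, x ∈ Set.Ioo (0:ℝ) 1 → Irrational x → ∀ j : ℕ, pquot x j = (a : ℤ) →
        ¬(j = 0 ∧ lam = 0) →
        ((a:ℝ) - (lam:ℝ)) * (lam:ℝ) / (a:ℝ) < medTheta x (lam : ℤ) j ∧
        medTheta x (lam : ℤ) j < ((a:ℝ) - (lam:ℝ) + 1) * ((lam:ℝ) + 1) / ((a:ℝ) + 2)) ∧
    ∀ᵐ x ∂(volume : Measure ℝ), x ∈ Set.Ioo (0:ℝ) 1 → Irrational x →
      {j : ℕ | pquot x j = (a : ℤ)}.Infinite ∧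
      ∃ Lf : ℝ → ℝ,
        (∀ z : ℝ, Tendsto (fun n : ℕ =>
              (((Finset.range n).filter fun k =>
                  medTheta x (lam : ℤ) (Nat.nth (fun j => pquot x j = (a : ℤ)) k) ≤ z).card : ℝ)
                / (n : ℝ))
            atTop (𝓝 (Lf z))) ∧
        (∀ z : ℝ, 1 ≤ lam →
            ((a:ℝ) - (lam:ℝ)) * (lam:ℝ) / (a:ℝ) ≤ z →
            z ≤ min (((a:ℝ) - (lam:ℝ) + 1) * (lam:ℝ)) (((a:ℝ) - (lam:ℝ)) * ((lam:ℝ) + 1))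
                  / ((a:ℝ) + 1) →
            Lf z = (1 / C11 a) * ((a:ℝ) * z / (((a:ℝ) - (lam:ℝ)) * (lam:ℝ)) - 1 +
              Real.log (((a:ℝ) - (lam:ℝ)) * (lam:ℝ) / ((a:ℝ) * z)))) ∧
        (∀ z : ℝ,
            ((a:ℝ) - (lam:ℝ)) * ((lam:ℝ) + 1) / ((a:ℝ) + 1) ≤ z →
            z ≤ ((a:ℝ) - (lam:ℝ) + 1) * (lam:ℝ) / ((a:ℝ) + 1) →
            Lf z = (1 / C11 a) * (z / ((lam:ℝ) * ((lam:ℝ) + 1)) +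
              Real.log (((a:ℝ) + 1) * (lam:ℝ) / ((a:ℝ) * ((lam:ℝ) + 1))))) ∧
        (∀ z : ℝ,
            ((a:ℝ) - (lam:ℝ) + 1) * (lam:ℝ) / ((a:ℝ) + 1) ≤ z →
            z ≤ ((a:ℝ) - (lam:ℝ)) * ((lam:ℝ) + 1) / ((a:ℝ) + 1) →
            Lf z = (1 / C11 a) * (z / (((a:ℝ) - (lam:ℝ)) * ((a:ℝ) - (lam:ℝ) + 1)) +
              Real.log (((a:ℝ) + 1) * ((a:ℝ) - (lam:ℝ)) / ((a:ℝ) * ((a:ℝ) - (lam:ℝ) + 1))))) ∧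
        (∀ z : ℝ,
            max (((a:ℝ) - (lam:ℝ) + 1) * (lam:ℝ)) (((a:ℝ) - (lam:ℝ)) * ((lam:ℝ) + 1))
                / ((a:ℝ) + 1) ≤ z →
            z ≤ ((a:ℝ) - (lam:ℝ) + 1) * ((lam:ℝ) + 1) / ((a:ℝ) + 2) →
            Lf z = (1 / C11 a) * (1 - ((a:ℝ) + 2) * z / (((a:ℝ) - (lam:ℝ) + 1) * ((lam:ℝ) + 1)) +
              Real.log (((a:ℝ) + 1) ^ 2 * z /
                ((a:ℝ) * (((a:ℝ) - (lam:ℝ) + 1) * ((lam:ℝ) + 1)))))) := by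
  have hla : lam ≤ a := by lia
  refine ⟨fun x hx hirr j hj h0 => lt_medTheta_and_lt ⟨hx, hirr⟩ hlam hj h0, ?_⟩
  have hm := gaussNEMeasure_univ_pos
  filter_upwards [ae_tendsto_medCount_div ha hlam] with x hx hx01 hirr
  have hxJ : x ∈ unitIrrational := ⟨hx01, hirr⟩
  have htot := hx hxJ (lam + 1)
  rw [gaussNEMeasure_real_medSublevel_add_one ha hlam] at htot
  have hc : 0 < C11 a / gaussNEMeasure.real Set.univ := div_pos (C11_pos ha) hm
  refine ⟨infinite_of_tendsto_medCount hc htot,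
    fun z => 1 / C11 a * gaussNEMeasure.real (medSublevel a lam z), fun z => ?_,
    fun z hl1 h1 h2 => ?_, fun z h1 h2 => ?_, fun z h1 h2 => ?_, fun z h1 h2 => ?_⟩
  · have h := tendsto_card_filter_nth_div hxJ hla hc htot (hx hxJ z)
    rwa [div_div_div_cancel_right₀ hm.ne', div_eq_inv_mul, ← one_div] at h
  · exact congrArg (1 / C11 a * ·) (gaussNEMeasure_real_medSublevel_of_le_min ha hlam hl1 h1 h2)
  · exact congrArg (1 / C11 a * ·) (gaussNEMeasure_real_medSublevel_of_mem_Icc ha hlam h1 h2)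
  · exact congrArg (1 / C11 a * ·) (gaussNEMeasure_real_medSublevel_of_mem_Icc' ha hlam h1 h2)
  · exact congrArg (1 / C11 a * ·) (gaussNEMeasure_real_medSublevel_of_max_le ha hlam h1 h2)
end

section
/- Let R ⊆ Ω be a proper inducible subregion and let x ∈ (0,1) be irrational with orbit F̄^k(x,1) entering R for infinitely many k ≥ 1. For every n ≥ 0, set r := N_{n+1} − N_n and let M := M_r(x_n^R) with entries M = [[u, t], [s, r']]. Then Θ_{n+1}^R(x) = det(M) · (u − s·x_n^R) · (u + (s − u)·y_n^R) / (x_n^R + y_n^R − x_n^R·y_n^R). -/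
open MeasureTheory Filter Topology
open scoped Classical

theorem fareyMap_mem_Icc {x : ℝ} (hx : x ∈ Set.Icc (0:ℝ) 1) : fareyMap x ∈ Set.Icc (0:ℝ) 1 := by
  obtain ⟨h0, h1⟩ := hx
  unfold fareyMap
  split_ifs with h
  · exact ⟨div_nonneg h0 (by linarith), (div_le_one (by linarith)).2 (by linarith)⟩
  · push Not at h
    exact ⟨div_nonneg (by linarith) h0, (div_le_one (by linarith)).2 (by linarith)⟩

theorem fareyMap_iterate_mem_Icc {x : ℝ} (hx : x ∈ Set.Icc (0:ℝ) 1) (n : ℕ) :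
    fareyMap^[n] x ∈ Set.Icc (0:ℝ) 1 := by
  induction n with
  | zero => exact hx
  | succ n ih =>
    rw [Function.iterate_succ_apply']
    exact fareyMap_mem_Icc ih

theorem fareyNE_iterate_fst (p : ℝ × ℝ) (n : ℕ) :
    (fareyNE^[n] p).1 = fareyMap^[n] p.1 := by
  have h : Function.Semiconj Prod.fst fareyNE fareyMap := by
    intro p
    unfold fareyNE fareyMap
    split_ifs <;> rfl
  exact h.iterate_right n p

theorem eps_add (x : ℝ) (m k : ℕ) : eps x (m + k) = eps (fareyMap^[m] x) k := by
  unfold eps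
  rw [add_comm, Function.iterate_add_apply]

/-- The cocycle identity for the matrices `M_n(x)` along the Farey orbit. -/
theorem Mmat_add (x : ℝ) (m k : ℕ) :
    Mmat x (m + k) = Mmat x m * Mmat (fareyMap^[m] x) k := by
  induction k with
  | zero => simp [Mmat]
  | succ k ih => rw [← add_assoc, Mmat, Mmat, ih, eps_add, mul_assoc]

theorem Mmat_det_sq (x : ℝ) (n : ℕ) : (Mmat x n).det ^ 2 = 1 := by
  induction n with
  | zero => simp [Mmat]
  | succ n ih =>
    rw [Mmat, Matrix.det_mul, mul_pow, ih]
    unfold eps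
    split_ifs <;> simp [Amat, Matrix.det_fin_two]

theorem Mmat_bottom_row_nonneg_pos (x : ℝ) (n : ℕ) : 0 ≤ Mmat x n 1 0 ∧ 0 < Mmat x n 1 1 := by
  induction n with
  | zero => simp [Mmat]
  | succ n ih =>
    rw [Mmat]
    unfold eps
    split_ifs <;> simp [Amat, Matrix.mul_apply, Fin.sum_univ_two] <;> omega

/-- The Möbius action of `M_n(x)` sends `F^n(x)` back to `x`. -/
theorem Mmat_mobius {x : ℝ} (hx : x ∈ Set.Icc (0:ℝ) 1) (n : ℕ) :
    x * ((Mmat x n 1 0 : ℝ) * fareyMap^[n] x + Mmat x n 1 1) =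
      (Mmat x n 0 0 : ℝ) * fareyMap^[n] x + Mmat x n 0 1 := by
  induction n with
  | zero => simp [Mmat]
  | succ n ih =>
    obtain ⟨h0, h1⟩ := fareyMap_iterate_mem_Icc hx n
    rw [Function.iterate_succ_apply', Mmat]
    simp only [eps]
    generalize fareyMap^[n] x = X at *
    unfold fareyMap
    split_ifs with h
    · have : 1 - X ≠ 0 := by linarith
      simp [Amat, Matrix.mul_apply, Fin.sum_univ_two]
      field_simp
      linear_combination ih
    · have : X ≠ 0 := by linarith
      simp [Amat, Matrix.mul_apply, Fin.sum_univ_two]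
      field_simp
      linear_combination ih

/-- The second coordinate of the orbit of `(x, 1)` is read off the bottom row of `M_n(x)`. -/
theorem fareyNE_iterate_snd (x : ℝ) (n : ℕ) :
    (fareyNE^[n] (x, 1)).2 = (Mmat x n 1 1 : ℝ) / (Mmat x n 1 0 + Mmat x n 1 1) := by
  induction n with
  | zero => simp [Mmat]
  | succ n ih =>
    obtain ⟨hs, hr⟩ := Mmat_bottom_row_nonneg_pos x n
    have hs' : (0:ℝ) ≤ Mmat x n 1 0 := by exact_mod_cast hs
    have hr' : (0:ℝ) < Mmat x n 1 1 := by exact_mod_cast hr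
    rw [Function.iterate_succ_apply', Mmat]
    simp only [eps, fareyNE, fareyNE_iterate_fst]
    split_ifs with h
    all_goals
      simp only [ih]
      simp [Amat, Matrix.mul_apply, Fin.sum_univ_two]
      field_simp
      try ring

theorem Mmat_left_column_sub {x : ℝ} (hx : x ∈ Set.Icc (0:ℝ) 1) (n : ℕ) :
    ((Mmat x n 0 0 : ℝ) - Mmat x n 1 0 * x) *
      ((Mmat x n 1 0 : ℝ) * fareyMap^[n] x + Mmat x n 1 1) = (Mmat x n).det := by
  rw [Matrix.det_fin_two]
  push_cast
  linear_combination (-(Mmat x n 1 0 : ℝ)) * Mmat_mobius hx n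

theorem Mmat_right_column_sub {x : ℝ} (hx : x ∈ Set.Icc (0:ℝ) 1) (n : ℕ) :
    ((Mmat x n 0 1 : ℝ) - Mmat x n 1 1 * x) *
      ((Mmat x n 1 0 : ℝ) * fareyMap^[n] x + Mmat x n 1 1) =
        -((Mmat x n).det * fareyMap^[n] x) := by
  rw [Matrix.det_fin_two]
  push_cast
  linear_combination (-(Mmat x n 1 1 : ℝ)) * Mmat_mobius hx n

theorem Mmat_bottom_row_mul_add_pos {x X : ℝ} (hX : 0 ≤ X) (n : ℕ) :
    0 < (Mmat x n 1 0 : ℝ) * X + Mmat x n 1 1 := by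
  obtain ⟨hs, hr⟩ := Mmat_bottom_row_nonneg_pos x n
  have hs' : (0:ℝ) ≤ Mmat x n 1 0 := by exact_mod_cast hs
  have hr' : (0:ℝ) < Mmat x n 1 1 := by exact_mod_cast hr
  positivity

theorem abs_sF_mul_sub_uF {x : ℝ} (hx : x ∈ Set.Icc (0:ℝ) 1) (n : ℕ) :
    |(sF x n : ℝ) * x - uF x n| =
      (Mmat x n).det * ((Mmat x n 0 0 : ℝ) - Mmat x n 1 0 * x) := by
  have hpos := Mmat_bottom_row_mul_add_pos (x := x) (fareyMap_iterate_mem_Icc hx n).1 n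
  have hcol := Mmat_left_column_sub hx n
  have hdet : ((Mmat x n).det : ℝ) ^ 2 = 1 := by exact_mod_cast Mmat_det_sq x n
  have hnonneg : 0 ≤ ((Mmat x n).det : ℝ) * ((Mmat x n 0 0 : ℝ) - Mmat x n 1 0 * x) := by
    refine nonneg_of_mul_nonneg_left (b := (Mmat x n 1 0 : ℝ) * fareyMap^[n] x + Mmat x n 1 1)
      ?_ hpos
    rw [mul_assoc, hcol, ← sq]
    positivity
  have habs : |((Mmat x n).det : ℝ)| = 1 := by
    rwa [← sq_eq_sq₀ (abs_nonneg _) zero_le_one, sq_abs, one_pow]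
  rw [← abs_of_nonneg hnonneg, abs_mul, habs, one_mul, abs_sub_comm]
  rfl

/-- The approximation coefficient at time `m + k` in terms of the orbit of `(x, 1)` at time `m`. -/
theorem ThetaF_add {x : ℝ} (hx : x ∈ Set.Icc (0:ℝ) 1) (m k : ℕ) {X y : ℝ}
    {M : Matrix (Fin 2) (Fin 2) ℤ} (hX : (fareyNE^[m] (x, 1)).1 = X)
    (hy : (fareyNE^[m] (x, 1)).2 = y) (hM : Mmat X k = M) :
    ThetaF x (m + k) =
      (M.det : ℝ) * ((M 0 0 : ℝ) - (M 1 0 : ℝ) * X) *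
        ((M 0 0 : ℝ) + ((M 1 0 : ℝ) - (M 0 0 : ℝ)) * y) / (X + y - X * y) := by
  rw [fareyNE_iterate_fst] at hX
  rw [fareyNE_iterate_snd] at hy
  have hpos := Mmat_bottom_row_mul_add_pos (x := x) (fareyMap_iterate_mem_Icc hx m).1 m
  have hsum := Mmat_bottom_row_mul_add_pos (x := x) zero_le_one m
  have hleft := Mmat_left_column_sub hx m
  have hright := Mmat_right_column_sub hx m
  have hdet : ((Mmat x m).det : ℝ) ^ 2 = 1 := by exact_mod_cast Mmat_det_sq x m
  rw [ThetaF, abs_sF_mul_sub_uF hx, sF, Mmat_add, Matrix.det_mul]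
  simp only [hX, hM, Matrix.mul_apply, Fin.sum_univ_two, Int.cast_mul, Int.cast_add] at *
  generalize ((Mmat x m).det : ℝ) = D at *
  generalize (Mmat x m 0 0 : ℝ) = u at *
  generalize (Mmat x m 0 1 : ℝ) = t at *
  generalize (Mmat x m 1 0 : ℝ) = s at *
  generalize (Mmat x m 1 1 : ℝ) = r at *
  rw [mul_one] at hsum
  have hden : X + y - X * y = (s * X + r) / (s + r) := by
    rw [← hy]
    field_simp
    ring
  have hnum : (M 0 0 : ℝ) + ((M 1 0 : ℝ) - M 0 0) * y = (s * M 0 0 + r * M 1 0) / (s + r) := by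
    rw [← hy]
    field_simp
    ring
  rw [hden, hnum, ← mul_div_assoc, div_div_div_cancel_right₀ hsum.ne', eq_div_iff hpos.ne']
  linear_combination (s * M 0 0 + r * M 1 0) * (M.det : ℝ) *
    (D * M 0 0 * hleft + D * M 1 0 * hright + (M 0 0 - M 1 0 * X) * hdet)

theorem Nidx_le_succ {R : Set (ℝ × ℝ)} {x : ℝ} (hinf : {k : ℕ | hitsR R x k}.Infinite) (n : ℕ) :
    Nidx R x n ≤ Nidx R x (n + 1) := by
  cases n with
  | zero => exact Nat.zero_le _
  | succ n => exact Nat.nth_monotone hinf n.le_succ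

/-- Proposition: `Θ_{n+1}^R(x)` is computed from `(x_n^R, y_n^R)` and the matrix
`M = M_r(x_n^R)` with `r = N_{n+1} − N_n`. -/
theorem stmt_14 (R : Set (ℝ × ℝ)) (hR : ProperInducible R)
    (x : ℝ) (hx : x ∈ Set.Ioo (0:ℝ) 1) (hirr : Irrational x)
    (hinf : {k : ℕ | hitsR R x k}.Infinite) (n : ℕ) :
    let xn := (fareyNE^[Nidx R x n] (x, 1)).1
    let yn := (fareyNE^[Nidx R x n] (x, 1)).2
    let r := Nidx R x (n + 1) - Nidx R x n
    let M := Mmat xn r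
    ThetaR R x (n + 1) =
      (M.det : ℝ) * ((M 0 0 : ℝ) - (M 1 0 : ℝ) * xn) *
        ((M 0 0 : ℝ) + ((M 1 0 : ℝ) - (M 0 0 : ℝ)) * yn) / (xn + yn - xn * yn) := by
  intro xn yn r M
  rw [ThetaR, ← Nat.add_sub_cancel' (Nidx_le_succ hinf n)]
  exact ThetaF_add (Set.Ioo_subset_Icc_self hx) _ _ rfl rfl rfl
end

section
/- Let x ∈ (0,1) be irrational and let j ≥ 0 be such that a := a_{j+1} ≥ 2. For 0 ≤ λ < a write m_λ := (λ p_j + p_{j−1})/(λ q_j + q_{j−1}), and set m_a := p_j/q_j. Then the maximum of Θ(x, m_λ) over all 0 ≤ λ ≤ a with (j, λ) ≠ (0, 0) is strictly greater than a/4 if a is even, and strictly greater than (a² − 1)/(4a) if a is odd. -/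
open MeasureTheory Filter Topology
open scoped Classical

theorem gaussMap_iterate_irrational {x : ℝ} (hx : x ∈ Set.Ioo (0:ℝ) 1) (hirr : Irrational x)
    (n : ℕ) : Irrational (gaussMap^[n] x) ∧ gaussMap^[n] x ∈ Set.Ioo (0:ℝ) 1 := by
  induction n with
  | zero => exact ⟨hirr, hx⟩
  | succ n ih =>
    obtain ⟨hi, -⟩ := ih
    rw [Function.iterate_succ_apply']
    have hfr : Irrational (gaussMap (gaussMap^[n] x)) := by
      rw [gaussMap, one_div, Int.fract]
      exact hi.inv.sub_intCast _
    exact ⟨hfr, lt_of_le_of_ne (Int.fract_nonneg _) hfr.ne_zero.symm, Int.fract_lt_one _⟩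

theorem one_div_gaussMap_iterate (x : ℝ) (n : ℕ) :
    1 / gaussMap^[n] x = pquot x n + gaussMap^[n + 1] x := by
  rw [Function.iterate_succ_apply']
  exact (Int.floor_add_fract _).symm

theorem pquot_pos {x : ℝ} (hx : x ∈ Set.Ioo (0:ℝ) 1) (hirr : Irrational x) (n : ℕ) :
    1 ≤ pquot x n := by
  obtain ⟨-, h0, h1⟩ := gaussMap_iterate_irrational hx hirr n
  rw [pquot, Int.le_floor, Int.cast_one]
  exact (one_lt_one_div h0 h1).le

theorem qden_nonneg_and_succ_pos {x : ℝ} (hx : x ∈ Set.Ioo (0:ℝ) 1) (hirr : Irrational x)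
    (n : ℕ) : 0 ≤ qden x n ∧ 0 < qden x (n + 1) := by
  induction n with
  | zero => simp [qden]
  | succ n ih =>
    obtain ⟨h0, h1⟩ := ih
    have ha := pquot_pos hx hirr n
    refine ⟨h1.le, ?_⟩
    rw [qden]
    positivity

theorem abs_pnum_qden_det (x : ℝ) (n : ℕ) :
    |pnum x (n + 1) * qden x n - pnum x n * qden x (n + 1)| = 1 := by
  induction n with
  | zero => simp [pnum, qden]
  | succ n ih =>
    rw [← ih, abs_sub_comm (pnum x (n + 1) * qden x n), pnum, qden]
    congr 1
    ring

/-- `x = (p_n + t p_{n-1}) / (q_n + t q_{n-1})`, where `t` is the `n`-th Gauss iterate of `x`. -/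
theorem qden_add_mul_eq_pnum_add {x : ℝ} (hx : x ∈ Set.Ioo (0:ℝ) 1) (hirr : Irrational x)
    (n : ℕ) : (qden x (n + 1) + gaussMap^[n] x * qden x n) * x
      = pnum x (n + 1) + gaussMap^[n] x * pnum x n := by
  induction n with
  | zero => simp [pnum, qden]
  | succ n ih =>
    have h := one_div_gaussMap_iterate x n
    obtain ⟨-, h0, -⟩ := gaussMap_iterate_irrational hx hirr n
    rw [div_eq_iff h0.ne'] at h
    apply mul_left_cancel₀ h0.ne'
    simp only [pnum, qden]
    push_cast
    linear_combination ih - (qden x (n + 1) * x - pnum x (n + 1)) * h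

/-- With `s = 1/t - a` the next Gauss iterate of `x`, the approximation coefficients of the
mediants are `(λ q_j + q_{j-1}) (a + s - λ) / ((a + s) q_j + q_{j-1})`. -/
theorem medTheta_eq_s17 {x : ℝ} (hx : x ∈ Set.Ioo (0:ℝ) 1) (hirr : Irrational x) (j : ℕ) {l : ℤ}
    (hl : l ≤ pquot x j) :
    medTheta x l j = (l * qden x (j + 1) + qden x j) * (pquot x j + gaussMap^[j + 1] x - l)
      / ((pquot x j + gaussMap^[j + 1] x) * qden x (j + 1) + qden x j) := by
  have hrel := qden_add_mul_eq_pnum_add hx hirr (j + 1)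
  have hdet := abs_pnum_qden_det x j
  obtain ⟨-, hs, -⟩ := gaussMap_iterate_irrational hx hirr (j + 1)
  obtain ⟨hq0, hq1⟩ := qden_nonneg_and_succ_pos hx hirr j
  have ha := pquot_pos hx hirr j
  simp only [pnum, qden] at hrel
  push_cast at hrel
  rw [medTheta, Theta]
  set s := gaussMap^[j + 1] x
  set a := pquot x j
  have hlr : (l : ℝ) ≤ a := by exact_mod_cast hl
  have har : (1 : ℝ) ≤ a := by exact_mod_cast ha
  have hq0r : (0 : ℝ) ≤ qden x j := by exact_mod_cast hq0
  have hq1r : (0 : ℝ) < qden x (j + 1) := by exact_mod_cast hq1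
  have hdetr : |(pnum x (j + 1) * qden x j - pnum x j * qden x (j + 1) : ℝ)| = 1 := by
    exact_mod_cast hdet
  have hW : 0 < (a + s) * qden x (j + 1) + qden x j := by positivity
  have hdiff : ((l * qden x (j + 1) + qden x j : ℤ) : ℝ) * x
      - ((l * pnum x (j + 1) + pnum x j : ℤ) : ℝ)
      = (pnum x (j + 1) * qden x j - pnum x j * qden x (j + 1))
        * ((a + s - l) / ((a + s) * qden x (j + 1) + qden x j)) := by
    rw [← mul_div_assoc, eq_div_iff hW.ne']
    push_cast
    linear_combination (l * qden x (j + 1) + qden x j : ℝ) * hrel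
  rw [hdiff, abs_mul, hdetr, one_mul, abs_of_nonneg (div_nonneg (by linarith) hW.le)]
  push_cast
  rw [mul_div_assoc]

/-- The maximum of the approximation coefficients of `p_j/q_j` and the mediants between
`p_{j−1}/q_{j−1}` and `p_j/q_j` exceeds `a/4` (`a` even) resp. `(a² − 1)/(4a)` (`a` odd). -/
theorem stmt_17 (x : ℝ) (hx : x ∈ Set.Ioo (0:ℝ) 1) (hirr : Irrational x)
    (j : ℕ) (ha : 2 ≤ pquot x j) :
    let a : ℤ := pquot x j
    let Th : ℤ → ℝ := fun lam =>
      if lam = a then Theta x (pnum x (j + 1)) (qden x (j + 1)) else medTheta x lam j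
    ∃ lam : ℤ, 0 ≤ lam ∧ lam ≤ a ∧ ¬(j = 0 ∧ lam = 0) ∧
      (if Even a then (a:ℝ) / 4 else ((a:ℝ) ^ 2 - 1) / (4 * (a:ℝ))) < Th lam := by
  intro a Th
  obtain ⟨-, hs, -⟩ := gaussMap_iterate_irrational hx hirr (j + 1)
  obtain ⟨hq0, hq1⟩ := qden_nonneg_and_succ_pos hx hirr j
  have hq0r : (0 : ℝ) ≤ qden x j := by exact_mod_cast hq0
  have hq1r : (0 : ℝ) < qden x (j + 1) := by exact_mod_cast hq1
  have ha2 : 2 ≤ a := ha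
  refine ⟨a / 2, by omega, by omega, by omega, ?_⟩
  have hTh : Th (a / 2) = medTheta x (a / 2) j := if_neg (by omega)
  rw [hTh, medTheta_eq_s17 hx hirr j (by change a / 2 ≤ a; omega)]
  change _ < _ * ((a : ℝ) + _ - _) / (((a : ℝ) + _) * _ + _)
  set s := gaussMap^[j + 1] x
  set q := (qden x (j + 1) : ℝ)
  set r := (qden x j : ℝ)
  generalize hk : a / 2 = k
  have hk1 : (1 : ℝ) ≤ k := by exact_mod_cast (by omega : 1 ≤ k)
  split_ifs with he
  · have hak : (a : ℝ) = 2 * k := by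
      obtain ⟨m, hm⟩ := he
      exact_mod_cast (by omega : a = 2 * k)
    rw [hak, div_lt_div_iff₀ (by norm_num) (by positivity), ← sub_pos]
    have : 0 < 2 * k * s * q + 2 * k * r + 4 * s * r := by positivity
    linarith
  · have hak : (a : ℝ) = 2 * k + 1 := by
      obtain ⟨m, hm⟩ := Int.not_even_iff_odd.mp he
      exact_mod_cast (by omega : a = 2 * k + 1)
    rw [hak, div_lt_div_iff₀ (by positivity) (by positivity), ← sub_pos]
    have : 0 < 4 * (s * k ^ 2 * q + (k + 1) ^ 2 * r + (2 * k + 1) * s * r) := by positivity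
    linarith
end
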